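/- arXiv:2208.06629 — 2 statements merged into one kernel-verified Lean document; each statement's English description precedes it below -/
import Mathlib

section
/- For every integer ℓ ≥ 0 and every integer r with 0 ≤ r < 3 such that t = 3ℓ + r ≥ 1, there exists a constant C > 0 (depending only on ℓ and r) such that for all integers n ≥ max(t, 2), U_t(n) ≤ (2ℓ + r)·n + C·log n. -/
open scoped BigOperators

/-- A lazy transposition on `n` positions, encoded as a triple `(a, b, p)`. -/
abbrev LazyT (n : ℕ) := Fin n × Fin n × ℝ

/-- The triple `(a, b, p)` is a valid lazy transposition: `a ≠ b` and `p ∈ [0,1]`. -/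
def LazyT.Valid {n : ℕ} (e : LazyT n) : Prop :=
  e.1 ≠ e.2.1 ∧ 0 ≤ e.2.2 ∧ e.2.2 ≤ 1

/-- A star transposition: its first coordinate is position `1` (index `0` in `Fin n`). -/
def LazyT.IsStar {n : ℕ} (e : LazyT n) : Prop := (e.1 : ℕ) = 0

/-- `permDist L σ` is the probability that the composition of the independent lazy
transpositions in `L` (applied in order) equals the permutation `σ`. -/
noncomputable def permDist {n : ℕ} : List (LazyT n) → Equiv.Perm (Fin n) → ℝ
  | [], σ => if σ = 1 then 1 else 0
  | e :: L, σ =>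
      e.2.2 * permDist L (σ * Equiv.swap e.1 e.2.1) + (1 - e.2.2) * permDist L σ

/-- `L` is a transposition shuffle on `n` points: all entries are valid lazy
transpositions and the composition is uniformly distributed on `Perm (Fin n)`. -/
def IsShuffle {n : ℕ} (L : List (LazyT n)) : Prop :=
  (∀ e ∈ L, e.Valid) ∧
  ∀ σ : Equiv.Perm (Fin n), permDist L σ = 1 / (n.factorial : ℝ)

/-- `U n` is the minimum length of a transposition shuffle on `n` points. -/
noncomputable def U (n : ℕ) : ℕ :=
  sInf { ℓ : ℕ | ∃ L : List (LazyT n), L.length = ℓ ∧ IsShuffle L }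

/-- The probability that, after applying the lazy transpositions in `L`, the `t`
labelled counters starting in positions `1, …, t` end up placed according to the
map `f` (counter `i` in position `f i`). -/
noncomputable def placeProb {n t : ℕ} (ht : t ≤ n) (L : List (LazyT n))
    (f : Fin t → Fin n) : ℝ :=
  ∑ σ : Equiv.Perm (Fin n),
    if ∀ i : Fin t, σ (Fin.castLE ht i) = f i then permDist L σ else 0

/-- `L` is a `(t,n)`-shuffle: all entries are valid and the final placement of the
`t` counters is uniform over all `n!/(n-t)!` injections. -/
def IsTShuffle {n t : ℕ} (ht : t ≤ n) (L : List (LazyT n)) : Prop :=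
  (∀ e ∈ L, e.Valid) ∧
  ∀ f : Fin t → Fin n, Function.Injective f →
    placeProb ht L f = ((n - t).factorial : ℝ) / (n.factorial : ℝ)

/-- `Ut t n` is the minimum length of a `(t,n)`-shuffle. -/
noncomputable def Ut (t n : ℕ) : ℕ :=
  sInf { ℓ : ℕ | ∃ (ht : t ≤ n) (L : List (LazyT n)), L.length = ℓ ∧ IsTShuffle ht L }

/-- The probability that after applying `L` the set of positions occupied by the
`t` (indistinguishable) counters starting in positions `1, …, t` is exactly `S`. -/
noncomputable def occProb {n t : ℕ} (ht : t ≤ n) (L : List (LazyT n))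
    (S : Finset (Fin n)) : ℝ :=
  ∑ σ : Equiv.Perm (Fin n),
    if Finset.image (fun i : Fin t => σ (Fin.castLE ht i)) Finset.univ = S
    then permDist L σ else 0

/-- `L` shuffles `t` indistinguishable counters over `n` positions: all entries are
valid and the occupied set is uniform over all `n.choose t` subsets of size `t`. -/
def IsIndShuffle {n t : ℕ} (ht : t ≤ n) (L : List (LazyT n)) : Prop :=
  (∀ e ∈ L, e.Valid) ∧
  ∀ S : Finset (Fin n), S.card = t → occProb ht L S = 1 / (n.choose t : ℝ)

/-- `Uhat t n` is the minimum length of a sequence of lazy transpositions shuffling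
`t` indistinguishable counters uniformly over `n` positions. -/
noncomputable def Uhat (t n : ℕ) : ℕ :=
  sInf { ℓ : ℕ | ∃ (ht : t ≤ n) (L : List (LazyT n)), L.length = ℓ ∧ IsIndShuffle ht L }

/-- `Ustar n` is the minimum length of a transposition shuffle on `n` points all of
whose lazy transpositions are star transpositions. -/
noncomputable def Ustar (n : ℕ) : ℕ :=
  sInf { ℓ : ℕ | ∃ L : List (LazyT n), L.length = ℓ ∧ IsShuffle L ∧ ∀ e ∈ L, e.IsStar }

/-- `Utstar t n` is the minimum length of a `(t,n)`-shuffle all of whose lazy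
transpositions are star transpositions. -/
noncomputable def Utstar (t n : ℕ) : ℕ :=
  sInf { ℓ : ℕ | ∃ (ht : t ≤ n) (L : List (LazyT n)),
    L.length = ℓ ∧ IsTShuffle ht L ∧ ∀ e ∈ L, e.IsStar }

namespace Shf

open Equiv Finset

/-- Expectation of a test function of the random permutation produced by the list. -/
noncomputable def Ex {α : Type} [DecidableEq α] :
    List (α × α × ℝ) → (Equiv.Perm α → ℝ) → ℝ
  | [], Φ => Φ 1
  | e :: L, Φ =>
      e.2.2 * Ex L (fun σ => Φ (σ * Equiv.swap e.1 e.2.1)) + (1 - e.2.2) * Ex L Φ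

/-- All entries of the list are lazy transpositions. -/
def VL {α : Type} (L : List (α × α × ℝ)) : Prop :=
  ∀ e ∈ L, e.1 ≠ e.2.1 ∧ 0 ≤ e.2.2 ∧ e.2.2 ≤ 1

section basic
variable {α : Type} [DecidableEq α]

lemma Ex_append (L M : List (α × α × ℝ)) (Φ : Perm α → ℝ) :
    Ex (L ++ M) Φ = Ex L (fun τ => Ex M (fun σ => Φ (σ * τ))) := by
  induction L generalizing Φ with
  | nil => simp [Ex]
  | cons e L ih => simp only [List.cons_append, Ex, ih, mul_assoc]

lemma Ex_const (L : List (α × α × ℝ)) (c : ℝ) : Ex L (fun _ => c) = c := by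
  induction L with
  | nil => simp [Ex]
  | cons e L ih => simp only [Ex, ih]; ring

lemma Ex_lin (L : List (α × α × ℝ)) (a b : ℝ) (Φ Ψ : Perm α → ℝ) :
    Ex L (fun σ => a * Φ σ + b * Ψ σ) = a * Ex L Φ + b * Ex L Ψ := by
  induction L generalizing Φ Ψ with
  | nil => simp [Ex]
  | cons e L ih => simp only [Ex, ih]; ring

lemma Ex_comm {β : Type} [DecidableEq β] (L : List (α × α × ℝ)) (M : List (β × β × ℝ))
    (f : Perm α → Perm β → ℝ) :
    Ex L (fun σ => Ex M (fun τ => f σ τ)) = Ex M (fun τ => Ex L (fun σ => f σ τ)) := by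
  induction L generalizing f with
  | nil => simp [Ex]
  | cons e L ih => simp only [Ex, ih, Ex_lin]

lemma Ex_expect {κ : Type} [Fintype κ] (L : List (α × α × ℝ)) (f : κ → Perm α → ℝ) :
    Ex L (fun σ => 𝔼 i, f i σ) = 𝔼 i, Ex L (f i) := by
  induction L generalizing f with
  | nil => simp [Ex]
  | cons e L ih => simp only [Ex, ih, expect_add_distrib, mul_expect]

end basic

/-- The list `L` makes the placement of counters at `x` uniform. -/
def Unif {α ι : Type} [Fintype α] [DecidableEq α] (L : List (α × α × ℝ)) (x : ι → α) : Prop :=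
  ∀ G : (ι → α) → ℝ, Ex L (fun σ => G (σ ∘ x)) = 𝔼 ρ : Perm α, G (ρ ∘ x)

lemma Unif.inv {α ι : Type} [Fintype α] [DecidableEq α] {L : List (α × α × ℝ)} {x : ι → α}
    (h : Unif L x) (Φ : Perm α → ℝ) (hΦ : ∀ σ σ' : Perm α, σ ∘ x = σ' ∘ x → Φ σ = Φ σ') :
    Ex L Φ = 𝔼 ρ, Φ ρ := by
  have hf : Function.FactorsThrough Φ (fun σ : Perm α => (σ ∘ x : ι → α)) :=
    fun a b hab => hΦ a b hab
  have := h (Function.extend (fun σ : Perm α => (σ ∘ x : ι → α)) Φ 0)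
  have e : ∀ σ : Perm α, Function.extend (fun σ : Perm α => (σ ∘ x : ι → α)) Φ 0 (σ ∘ x) = Φ σ :=
    fun σ => hf.extend_apply 0 σ
  simpa only [e] using this

/-- Transport of a list along a map of positions. -/
def mapL {α β : Type} (φ : α → β) (L : List (α × α × ℝ)) : List (β × β × ℝ) :=
  L.map (fun e => (φ e.1, φ e.2.1, e.2.2))

lemma mapL_length {α β : Type} (φ : α → β) (L : List (α × α × ℝ)) :
    (mapL φ L).length = L.length := by simp [mapL]

lemma VL_mapL {α β : Type} (φ : α ↪ β) {L : List (α × α × ℝ)} (h : VL L) : VL (mapL φ L) := by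
  intro e he
  simp only [mapL, List.mem_map] at he
  obtain ⟨a, ha, rfl⟩ := he
  have := h a ha
  exact ⟨fun h' => this.1 (φ.injective h'), this.2⟩

lemma VL_append {α : Type} {L M : List (α × α × ℝ)} (h : VL L) (h' : VL M) : VL (L ++ M) := by
  intro e he
  rcases List.mem_append.1 he with he | he
  · exact h e he
  · exact h' e he

lemma VL_single {α : Type} {a b : α} {p : ℝ} (h : a ≠ b) (h0 : 0 ≤ p) (h1 : p ≤ 1) :
    VL [(a, b, p)] := by
  intro e he
  simp only [List.mem_singleton] at he
  subst he
  exact ⟨h, h0, h1⟩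

section via
variable {α β : Type}

/-- Extension of a permutation along an embedding. -/
noncomputable def via (φ : α ↪ β) : Perm α →* Perm β := Perm.viaEmbeddingHom φ

@[simp] lemma via_apply (φ : α ↪ β) (σ : Perm α) (a : α) : via φ σ (φ a) = φ (σ a) := by
  simp [via, Perm.viaEmbeddingHom_apply, Perm.viaEmbedding_apply]

lemma via_apply_not (φ : α ↪ β) (σ : Perm α) (b : β) (hb : b ∉ Set.range φ) :
    via φ σ b = b := by
  simp [via, Perm.viaEmbeddingHom_apply, Perm.viaEmbedding_apply_of_notMem _ _ _ hb]

lemma via_swap [DecidableEq α] [DecidableEq β] (φ : α ↪ β) (a b : α) :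
    via φ (swap a b) = swap (φ a) (φ b) := by
  ext c
  by_cases hc : c ∈ Set.range φ
  · obtain ⟨d, rfl⟩ := hc
    rw [via_apply]
    simp only [swap_apply_def, φ.injective.eq_iff]
    split_ifs <;> rfl
  · rw [via_apply_not _ _ _ hc, swap_apply_of_ne_of_ne]
    · rintro rfl; exact hc ⟨a, rfl⟩
    · rintro rfl; exact hc ⟨b, rfl⟩

lemma Ex_mapL [DecidableEq α] [DecidableEq β] (φ : α ↪ β) (L : List (α × α × ℝ))
    (Φ : Perm β → ℝ) : Ex (mapL φ L) Φ = Ex L (fun σ => Φ (via φ σ)) := by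
  induction L generalizing Φ with
  | nil => simp [Ex, mapL]
  | cons e L ih =>
    have : mapL φ (e :: L) = (φ e.1, φ e.2.1, e.2.2) :: mapL φ L := rfl
    rw [this]
    simp only [Ex, ih, map_mul, via_swap]

lemma via_surj [Finite α] (φ : α ↪ β) (u : Perm β) (hu : ∀ b, b ∉ Set.range φ → u b = b) :
    ∃ π, via φ π = u := by
  have h : ∀ a, ∃ a', φ a' = u (φ a) := by
    intro a
    by_contra hc
    have h1 := hu (u (φ a)) hc
    have h2 := u.injective h1
    exact hc ⟨a, h2.symm⟩
  choose f hf using h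
  have hinj : Function.Injective f := by
    intro a b hab
    apply φ.injective
    apply u.injective
    rw [← hf, ← hf, hab]
  refine ⟨Equiv.ofBijective f (Finite.injective_iff_bijective.1 hinj), ?_⟩
  ext b
  by_cases hb : b ∈ Set.range φ
  · obtain ⟨a, rfl⟩ := hb
    rw [via_apply, ← hf]; rfl
  · rw [via_apply_not _ _ _ hb, hu _ hb]

end via

lemma ext_perm {α ι : Type} [Finite α] {x y : ι → α} (hx : Function.Injective x)
    (hy : Function.Injective y) : ∃ u : Perm α, u ∘ x = y := by
  classical
  let e : {a // a ∈ Set.range x} ≃ {a // a ∈ Set.range y} :=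
    (Equiv.ofInjective x hx).symm.trans (Equiv.ofInjective y hy)
  refine ⟨e.extendSubtype, ?_⟩
  ext i
  have := e.extendSubtype_apply_of_mem (x i) ⟨i, rfl⟩
  simp only [Function.comp_apply]
  rw [this]
  have h2 : (Equiv.ofInjective x hx).symm ⟨x i, ⟨i, rfl⟩⟩ = i :=
    Equiv.ofInjective_symm_apply hx i
  simp only [e, Equiv.trans_apply]
  rw [h2]
  rfl

section mean
variable {α ι : Type} [Fintype α] [DecidableEq α]

lemma mean_mulLeft (u : Perm α) (Φ : Perm α → ℝ) : 𝔼 ρ, Φ (u * ρ) = 𝔼 ρ, Φ ρ :=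
  Fintype.expect_equiv (Equiv.mulLeft u) _ _ (fun _ => rfl)

lemma mean_mulRight (u : Perm α) (Φ : Perm α → ℝ) : 𝔼 ρ, Φ (ρ * u) = 𝔼 ρ, Φ ρ :=
  Fintype.expect_equiv (Equiv.mulRight u) _ _ (fun _ => rfl)

lemma mean_left (u : Perm α) (x : ι → α) (G : (ι → α) → ℝ) :
    𝔼 ρ : Perm α, G (u ∘ ρ ∘ x) = 𝔼 ρ : Perm α, G (ρ ∘ x) :=
  mean_mulLeft u (fun ρ => G (ρ ∘ x))

lemma mean_right (u : Perm α) (x : ι → α) (G : (ι → α) → ℝ) :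
    𝔼 ρ : Perm α, G (ρ ∘ u ∘ x) = 𝔼 ρ : Perm α, G (ρ ∘ x) :=
  mean_mulRight u (fun ρ => G (ρ ∘ x))

lemma mean_reindex {x : ι → α} (hx : Function.Injective x) (τ : Perm ι) (G : (ι → α) → ℝ) :
    𝔼 ρ : Perm α, G (ρ ∘ x ∘ τ) = 𝔼 ρ : Perm α, G (ρ ∘ x) := by
  obtain ⟨u, hu⟩ := ext_perm hx (hx.comp τ.injective)
  have := mean_right u x G
  rw [hu] at this
  exact this

end mean

/-- There are `(t,n)`-shuffles of length at most `N`. -/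
def Sh (t n N : ℕ) : Prop :=
  ∀ (α : Type) [Fintype α] [DecidableEq α], Fintype.card α = n →
    ∀ x : Fin t → α, Function.Injective x →
      ∃ L : List (α × α × ℝ), L.length ≤ N ∧ VL L ∧ Unif L x

lemma Sh.mono {t n N M : ℕ} (h : Sh t n N) (hNM : N ≤ M) : Sh t n M := by
  intro α _ _ hα x hx
  obtain ⟨L, h1, h2⟩ := h α hα x hx
  exact ⟨L, h1.trans hNM, h2⟩

lemma Sh.of_one {t n N : ℕ} {α : Type} [Fintype α] [DecidableEq α] (hα : Fintype.card α = n)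
    (x : Fin t → α) (hx : Function.Injective x) (L : List (α × α × ℝ)) (hL : L.length ≤ N)
    (hV : VL L) (hU : Unif L x) : Sh t n N := by
  intro β _ _ hβ y hy
  obtain ⟨e0⟩ : Nonempty (α ≃ β) := Fintype.card_eq.1 (hα.trans hβ.symm)
  obtain ⟨u, hu⟩ := ext_perm (e0.injective.comp hx) hy
  let e : α ≃ β := e0.trans u
  have he : e ∘ x = y := by rw [← hu]; rfl
  refine ⟨mapL e.toEmbedding L, by rwa [mapL_length], VL_mapL _ hV, ?_⟩
  intro G
  rw [Ex_mapL]
  have key : ∀ σ : Perm α, (via e.toEmbedding σ) ∘ y = e ∘ (σ ∘ x) := by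
    intro σ
    ext i
    rw [← he]
    exact via_apply e.toEmbedding σ (x i)
  simp only [key]
  rw [hU (fun z => G (e ∘ z))]
  refine Fintype.expect_equiv e.permCongr _ _ ?_
  intro σ
  congr 1
  ext i
  rw [← he]
  simp [Equiv.permCongr_apply]

lemma Sh.zero (n : ℕ) : Sh 0 n 0 := by
  intro α _ _ hα x hx
  refine ⟨[], by simp, by intro e he; simp at he, ?_⟩
  intro G
  have : ∀ σ : Perm α, G (σ ∘ x) = G x := fun σ => by congr 1; exact Subsingleton.elim _ _
  simp only [this, Ex_const, Fintype.expect_const]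

lemma Sh.one_one : Sh 1 1 0 := by
  intro α _ _ hα x hx
  refine ⟨[], by simp, by intro e he; simp at he, ?_⟩
  have : Subsingleton α := Fintype.card_le_one_iff_subsingleton.1 hα.le
  intro G
  have : ∀ σ : Perm α, G (σ ∘ x) = G x := fun σ => by congr 1; exact Subsingleton.elim _ _
  simp only [this, Ex_const, Fintype.expect_const]

/-- Composition: shuffle `t` counters away from `s` positions, then shuffle the `s` positions. -/
lemma Sh.comp {s t n N M : ℕ} (h1 : Sh s n N) (h2 : Sh t (n - s) M) :
    Sh (s + t) n (N + M) := by
  intro α _ _ hα x hx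
  let xs : Fin s → α := x ∘ Fin.castAdd t
  have hxs : Function.Injective xs := hx.comp (Fin.castAdd_injective s t)
  let φ : {a // a ∉ Set.range xs} ↪ α := Function.Embedding.subtype _
  have hφ : ∀ b, b ∉ Set.range φ ↔ b ∈ Set.range xs := by
    intro b; simp [φ]
  have hcard : Fintype.card {a // a ∉ Set.range xs} = n - s := by
    classical
    rw [Fintype.card_subtype_compl, hα]
    congr 1
    have := Fintype.card_congr (Equiv.ofInjective xs hxs)
    rw [Fintype.card_fin] at this
    refine Eq.trans ?_ this.symm
    exact Fintype.card_congr (Equiv.refl _)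
  have hne : ∀ j, x (Fin.natAdd s j) ∉ Set.range xs := by
    rintro j ⟨i, hi⟩
    have := hx hi
    rw [Fin.ext_iff] at this
    simp at this
    omega
  let xt : Fin t → {a // a ∉ Set.range xs} := fun j => ⟨x (Fin.natAdd s j), hne j⟩
  have hxt : Function.Injective xt := by
    intro a b hab
    have := hx (congrArg Subtype.val hab)
    exact Fin.natAdd_injective _ _ this
  obtain ⟨L2, hL2, hV2, hU2⟩ := h1 α hα xs hxs
  obtain ⟨L1, hL1, hV1, hU1⟩ := h2 _ hcard xt hxt
  refine ⟨mapL φ L1 ++ L2, ?_, VL_append (VL_mapL _ hV1) hV2, ?_⟩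
  · rw [List.length_append, mapL_length]; omega
  have hfix : ∀ τ i, via φ τ (xs i) = xs i := fun τ i =>
    via_apply_not _ _ _ ((hφ _).2 ⟨i, rfl⟩)
  intro G
  rw [Ex_append, Ex_mapL, Ex_comm]
  have step : ∀ σ : Perm α, Ex L1 (fun τ => G (⇑(σ * via φ τ) ∘ x))
      = 𝔼 τ, G (⇑(σ * via φ τ) ∘ x) := by
    intro σ
    apply hU1.inv
    intro τ τ' h
    congr 1
    ext i
    simp only [Function.comp_apply, Perm.mul_apply]
    congr 1
    refine Fin.addCases (fun i => ?_) (fun j => ?_) i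
    · exact (hfix τ i).trans (hfix τ' i).symm
    · have := congrFun h j
      have e1 := via_apply φ τ (xt j)
      have e2 := via_apply φ τ' (xt j)
      simp only [Function.comp_apply] at this
      rw [this] at e1
      exact e1.trans e2.symm
  simp only [step]
  rw [hU2.inv]
  · rw [expect_comm]
    have : ∀ τ, 𝔼 σ : Perm α, G (⇑(σ * via φ τ) ∘ x) = 𝔼 σ : Perm α, G (σ ∘ x) :=
      fun τ => mean_mulRight (via φ τ) (fun σ => G (σ ∘ x))
    simp only [this, Fintype.expect_const]
  · intro σ σ' h
    obtain ⟨τ0, hτ0⟩ := via_surj φ (σ⁻¹ * σ') (by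
      intro b hb
      obtain ⟨i, rfl⟩ := (hφ b).1 hb
      have := congrFun h i
      simp only [Function.comp_apply] at this
      rw [Perm.mul_apply, ← this]; simp)
    have e : σ' = σ * via φ τ0 := by rw [hτ0]; group
    rw [e]
    simp only [mul_assoc, ← map_mul]
    exact (mean_mulLeft τ0 (fun τ => G (⇑(σ * via φ τ) ∘ x))).symm

/-- Symmetrising `t` counters among themselves. -/
lemma Sh.symm {t S : ℕ} (h : Sh t t S) {α : Type} [Fintype α] [DecidableEq α]
    (x : Fin t → α) (hx : Function.Injective x) :
    ∃ L : List (α × α × ℝ), L.length ≤ S ∧ VL L ∧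
      ∀ G : (Fin t → α) → ℝ, Ex L (fun σ => G (σ ∘ x)) = 𝔼 τ : Perm (Fin t), G (x ∘ τ) := by
  obtain ⟨L, hL, hV, hU⟩ := h (Fin t) (by simp) id Function.injective_id
  refine ⟨mapL (⟨x, hx⟩ : Fin t ↪ α) L, by rwa [mapL_length], VL_mapL _ hV, ?_⟩
  intro G
  rw [Ex_mapL]
  have key : ∀ σ : Perm (Fin t), (via (⟨x, hx⟩ : Fin t ↪ α) σ) ∘ x = x ∘ σ := by
    intro σ; ext i; exact via_apply (⟨x, hx⟩ : Fin t ↪ α) σ i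
  simp only [key]
  exact hU (fun z => G (x ∘ z))

lemma mean_two {Ω : Type} [Fintype Ω] [Nonempty Ω] (E : Ω → Prop) [DecidablePred E] (A B : ℝ) :
    𝔼 ω, (if E ω then B else A) = A + (𝔼 ω, if E ω then (1:ℝ) else 0) * (B - A) := by
  have : ∀ ω, (if E ω then B else A) = A + (if E ω then (1:ℝ) else 0) * (B - A) := by
    intro ω; split_ifs <;> ring
  simp only [this, expect_add_distrib, Fintype.expect_const, ← expect_mul]

lemma prob_nonneg {Ω : Type} [Fintype Ω] (E : Ω → Prop) [DecidablePred E] :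
    0 ≤ 𝔼 ω, (if E ω then (1:ℝ) else 0) :=
  expect_nonneg (fun _ _ => by split_ifs <;> norm_num)

lemma prob_le_one {Ω : Type} [Fintype Ω] [Nonempty Ω] (E : Ω → Prop) [DecidablePred E] :
    𝔼 ω, (if E ω then (1:ℝ) else 0) ≤ 1 :=
  expect_le univ_nonempty (fun _ _ => by split_ifs <;> norm_num)

/-- Adding one position. -/
lemma Sh.succ {t S n N : ℕ} (hS : Sh (t + 1) (t + 1) S) (h : Sh (t + 1) n N) (hn : t + 1 ≤ n) :
    Sh (t + 1) (n + 1) (S + 1 + N) := by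
  classical
  let α := Fin n ⊕ Unit
  let φ : Fin n ↪ α := Function.Embedding.inl
  let x' : Fin (t + 1) → Fin n := Fin.castLE hn
  have hx' : Function.Injective x' := Fin.castLE_injective hn
  let x : Fin (t + 1) → α := φ ∘ x'
  have hx : Function.Injective x := φ.injective.comp hx'
  let z : α := Sum.inr ()
  let s : Perm α := swap (x (Fin.last t)) z
  obtain ⟨LS, hLS, hVS, hUS⟩ := hS.symm x hx
  obtain ⟨L, hL, hV, hU⟩ := h (Fin n) (by simp) x' hx'
  let E : (Fin (t + 1) → α) → Prop := fun y => ∃ i, y i = z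
  let p : ℝ := 𝔼 ρ : Perm α, if E (ρ ∘ x) then (1:ℝ) else 0
  have hφz : z ∉ Set.range φ := by rintro ⟨a, ha⟩; exact Sum.inl_ne_inr ha
  have hzφ : ∀ b : α, b ∉ Set.range φ → b = z := by
    rintro (a | a) hb
    · exact absurd ⟨a, rfl⟩ hb
    · rfl
  refine Sh.of_one (α := α) (by simp [α]) x hx
    (LS ++ ([(x (Fin.last t), z, p)] ++ mapL φ L)) ?_ ?_ ?_
  · simp only [List.length_append, mapL_length, List.length_singleton]; omega
  · refine VL_append hVS (VL_append (VL_single ?_ (prob_nonneg _) (prob_le_one _)) (VL_mapL _ hV))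
    exact Sum.inl_ne_inr
  intro G
  let Gb : (Fin (t + 1) → α) → ℝ := fun y =>
    𝔼 τ : Perm (Fin (t + 1)), 𝔼 π : Perm (Fin n), G (via φ π ∘ y ∘ τ)
  have invτ : ∀ y (τ : Perm (Fin (t + 1))), Gb (y ∘ τ) = Gb y := fun y τ0 =>
    mean_mulLeft τ0 (fun τ => 𝔼 π : Perm (Fin n), G (via φ π ∘ y ∘ τ))
  have invπ : ∀ y (π : Perm (Fin n)), Gb (via φ π ∘ y) = Gb y := by
    intro y π0
    refine expect_congr rfl (fun τ _ => ?_)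
    have := mean_mulRight π0 (fun π => G (via φ π ∘ y ∘ τ))
    rw [← this]
    simp only [map_mul]
    rfl
  have mean : 𝔼 ρ : Perm α, Gb (ρ ∘ x) = 𝔼 ρ : Perm α, G (ρ ∘ x) := by
    simp only [Gb]
    rw [expect_comm]
    have : ∀ τ : Perm (Fin (t + 1)), 𝔼 ρ : Perm α, 𝔼 π : Perm (Fin n), G (via φ π ∘ (ρ ∘ x) ∘ τ)
        = 𝔼 ρ : Perm α, G (ρ ∘ x) := by
      intro τ
      rw [expect_comm]
      have : ∀ π : Perm (Fin n), 𝔼 ρ : Perm α, G (via φ π ∘ (ρ ∘ x) ∘ τ)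
          = 𝔼 ρ : Perm α, G (ρ ∘ x) := by
        intro π
        rw [← mean_reindex hx τ G]
        exact mean_left (via φ π) (x ∘ τ) G
      simp only [this, Fintype.expect_const]
    simp only [this, Fintype.expect_const]
  have hsx : (s ∘ x) (Fin.last t) = z := swap_apply_left _ _
  have val : ∀ y, Function.Injective y → Gb y = if E y then Gb (s ∘ x) else Gb x := by
    intro y hy
    split_ifs with hE
    · obtain ⟨i, hi⟩ := hE
      rw [← invτ y (swap i (Fin.last t))]
      obtain ⟨u, hu⟩ := ext_perm (s.injective.comp hx)
        (hy.comp (swap i (Fin.last t)).injective)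
      obtain ⟨π, hπ⟩ := via_surj φ u (by
        intro b hb
        rw [hzφ b hb]
        have := congrFun hu (Fin.last t)
        rw [Function.comp_apply, hsx] at this
        rw [this]
        simp [hi])
      rw [← hu, ← hπ, invπ]
    · have : ∀ i, ∃ a, φ a = y i := by
        intro i
        by_contra hc
        exact hE ⟨i, hzφ _ hc⟩
      choose w hw using this
      have hwi : Function.Injective w := by
        intro a b hab
        apply hy
        rw [← hw, ← hw, hab]
      obtain ⟨π, hπ⟩ := ext_perm hx' hwi
      have : y = via φ π ∘ x := by
        ext i
        rw [← hw, ← hπ]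
        exact (via_apply φ π (x' i)).symm
      rw [this, invπ]
  rw [Ex_append, ]
  have LHS : ∀ τ : Perm α, Ex ([(x (Fin.last t), z, p)] ++ mapL φ L)
      (fun σ => G (⇑(σ * τ) ∘ x)) =
      (fun y => p * Ex L (fun σ => G (via φ σ ∘ s ∘ y)) + (1 - p) * Ex L (fun σ => G (via φ σ ∘ y)))
        (τ ∘ x) := by
    intro τ
    simp only [List.singleton_append, Ex, Ex_mapL]
    rfl
  simp only [LHS]
  rw [hUS (fun y => p * Ex L (fun σ => G (via φ σ ∘ s ∘ y))
    + (1 - p) * Ex L (fun σ => G (via φ σ ∘ y)))]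
  have viax : ∀ σ σ' : Perm (Fin n), σ ∘ x' = σ' ∘ x' → ∀ i, via φ σ (x i) = via φ σ' (x i) := by
    intro σ σ' h i
    have := congrFun h i
    simp only [Function.comp_apply] at this
    rw [show x i = φ (x' i) from rfl, via_apply, via_apply, this]
  have i1 : ∀ τ : Perm (Fin (t + 1)), Ex L (fun σ => G (via φ σ ∘ x ∘ τ))
      = 𝔼 σ : Perm (Fin n), G (via φ σ ∘ x ∘ τ) := by
    intro τ
    apply hU.inv
    intro σ σ' h
    congr 1
    ext i
    exact viax σ σ' h (τ i)
  have i2 : ∀ τ : Perm (Fin (t + 1)), Ex L (fun σ => G (via φ σ ∘ s ∘ x ∘ τ))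
      = 𝔼 σ : Perm (Fin n), G (via φ σ ∘ s ∘ x ∘ τ) := by
    intro τ
    apply hU.inv
    intro σ σ' h
    congr 1
    ext i
    simp only [Function.comp_apply]
    by_cases hi : τ i = Fin.last t
    · have : s (x (τ i)) = z := by rw [hi]; exact hsx
      rw [this, via_apply_not _ _ _ hφz, via_apply_not _ _ _ hφz]
    · have : s (x (τ i)) = x (τ i) :=
        swap_apply_of_ne_of_ne (fun h => hi (hx h)) Sum.inl_ne_inr
      rw [this]
      exact viax σ σ' h (τ i)
  simp only [i1, i2, expect_add_distrib, ← mul_expect]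
  rw [← mean]
  have : ∀ ρ : Perm α, Gb (ρ ∘ x) = if E (ρ ∘ x) then Gb (s ∘ x) else Gb x :=
    fun ρ => val _ (ρ.injective.comp hx)
  rw [expect_congr rfl (fun ρ _ => this ρ), mean_two (fun ρ : Perm α => E (ρ ∘ x))]
  change p * Gb (s ∘ x) + (1 - p) * Gb x = Gb x + p * (Gb (s ∘ x) - Gb x)
  ring

section prob
variable {α : Type} [Fintype α] [DecidableEq α]

lemma prob_point (a b : α) :
    (𝔼 ρ : Perm α, if ρ a = b then (1:ℝ) else 0) = 1 / (Fintype.card α : ℝ) := by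
  have hc : ∀ b', (𝔼 ρ : Perm α, if ρ a = b' then (1:ℝ) else 0)
      = 𝔼 ρ : Perm α, if ρ a = b then (1:ℝ) else 0 := by
    intro b'
    rw [← mean_mulLeft (swap b b') (fun ρ => if ρ a = b' then (1:ℝ) else 0)]
    refine expect_congr rfl (fun ρ _ => ?_)
    congr 1
    rw [Perm.mul_apply, swap_apply_eq_iff, swap_apply_right]
  have hs : ∑ b', (𝔼 ρ : Perm α, if ρ a = b' then (1:ℝ) else 0) = 1 := by
    rw [← expect_sum_comm]
    simp
  simp only [hc, sum_const, card_univ, nsmul_eq_mul] at hs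
  have : Nonempty α := ⟨a⟩
  have hpos : (0:ℝ) < Fintype.card α := by exact_mod_cast Fintype.card_pos
  field_simp
  linarith

lemma prob_partner (c : α → α) (hcc : ∀ y, c y ≠ y) (a b : α) (hab : a ≠ b) :
    (𝔼 ρ : Perm α, if ρ a = c (ρ b) then (1:ℝ) else 0) = 1 / ((Fintype.card α : ℝ) - 1) := by
  have hc : ∀ a' ∈ univ.erase b, (𝔼 ρ : Perm α, if ρ a' = c (ρ b) then (1:ℝ) else 0)
      = 𝔼 ρ : Perm α, if ρ a = c (ρ b) then (1:ℝ) else 0 := by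
    intro a' ha'
    rw [← mean_mulRight (swap a a') (fun ρ => if ρ a' = c (ρ b) then (1:ℝ) else 0)]
    refine expect_congr rfl (fun ρ _ => ?_)
    rw [Perm.mul_apply, Perm.mul_apply, swap_apply_right,
      swap_apply_of_ne_of_ne hab.symm (ne_of_mem_erase ha').symm]
  have hs : ∑ a' ∈ univ.erase b, (𝔼 ρ : Perm α, if ρ a' = c (ρ b) then (1:ℝ) else 0) = 1 := by
    rw [← expect_sum_comm]
    have : ∀ ρ : Perm α, ∑ a' ∈ univ.erase b, (if ρ a' = c (ρ b) then (1:ℝ) else 0) = 1 := by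
      intro ρ
      rw [sum_eq_single (ρ.symm (c (ρ b)))]
      · simp
      · intro a' _ hne
        rw [if_neg]
        intro h
        apply hne
        rw [← h]; simp
      · intro h
        exfalso
        apply h
        rw [mem_erase]
        refine ⟨?_, mem_univ _⟩
        intro h
        rw [Equiv.symm_apply_eq] at h
        exact hcc _ h
    simp only [this, Fintype.expect_const]
  rw [sum_congr rfl hc] at hs
  rw [sum_const, card_erase_of_mem (mem_univ _), card_univ, nsmul_eq_mul] at hs
  have h2 : 1 < Fintype.card α := Fintype.one_lt_card_iff.2 ⟨a, b, hab⟩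
  rw [Nat.cast_sub h2.le] at hs
  have hpos : (1:ℝ) < Fintype.card α := by exact_mod_cast h2
  push_cast at hs
  have : (Fintype.card α : ℝ) - 1 ≠ 0 := by linarith
  field_simp
  linarith

end prob

section dbl
variable {β : Type}

/-- Swapping the two members of pair `b`. -/
def fl [DecidableEq β] (b : β) : Perm (β ⊕ β) := swap (Sum.inl b) (Sum.inr b)

/-- The diagonal action. -/
def dbl (π : Perm β) : Perm (β ⊕ β) := Equiv.sumCongr π π

/-- The final layer. -/
noncomputable def S4 (l : List β) : List ((β ⊕ β) × (β ⊕ β) × ℝ) :=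
  l.map (fun b => (Sum.inl b, Sum.inr b, 1 / 2))

/-- The pair containing a position. -/
def pr (y : β ⊕ β) : β := Sum.elim id id y

@[simp] lemma dbl_inl (π : Perm β) (b : β) : dbl π (Sum.inl b) = Sum.inl (π b) := rfl
@[simp] lemma dbl_inr (π : Perm β) (b : β) : dbl π (Sum.inr b) = Sum.inr (π b) := rfl
@[simp] lemma fl_inl [DecidableEq β] (b : β) : fl b (Sum.inl b) = Sum.inr b := swap_apply_left _ _
@[simp] lemma fl_inr [DecidableEq β] (b : β) : fl b (Sum.inr b) = Sum.inl b := swap_apply_right _ _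
@[simp] lemma pr_inl (b : β) : pr (Sum.inl b : β ⊕ β) = b := rfl
@[simp] lemma pr_inr (b : β) : pr (Sum.inr b : β ⊕ β) = b := rfl

variable [DecidableEq β]

lemma fl_ne (b : β) (y : β ⊕ β) (h : pr y ≠ b) : fl b y = y := by
  apply swap_apply_of_ne_of_ne
  · rintro rfl; exact h rfl
  · rintro rfl; exact h rfl

lemma dbl_fl (π : Perm β) (b : β) : dbl π * fl b = fl (π b) * dbl π := by
  ext y
  simp only [Perm.mul_apply]
  by_cases h : pr y = b
  · rcases y with y | y
    · simp at h; subst h; simp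
    · simp at h; subst h; simp
  · rw [fl_ne b y h, fl_ne]
    rcases y with y | y <;> simpa using h

lemma fl_comm (a b : β) : fl a * fl b = fl b * fl a := by
  by_cases hab : a = b
  · rw [hab]
  ext y
  simp only [Perm.mul_apply]
  by_cases ha : pr y = a
  · have h1 : pr y ≠ b := by rw [ha]; exact hab
    rw [fl_ne b y h1, fl_ne b]
    rcases y with y | y
    · simp at ha; subst ha; simpa using h1
    · simp at ha; subst ha; simpa using h1
  · rw [fl_ne a y ha]
    by_cases hb : pr y = b
    · rw [fl_ne a]
      rcases y with y | y
      · simp at hb; subst hb; simpa using ha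
      · simp at hb; subst hb; simpa using ha
    · rw [fl_ne b y hb, fl_ne a y ha]

lemma S4_inv (l : List β) (b : β) (hb : b ∈ l) (Φ : Perm (β ⊕ β) → ℝ) :
    Ex (S4 l) (fun ε => Φ (ε * fl b)) = Ex (S4 l) Φ := by
  induction l generalizing Φ with
  | nil => simp at hb
  | cons a l ih =>
    have e : S4 (a :: l) = (Sum.inl a, Sum.inr a, 1 / 2) :: S4 l := rfl
    rw [e]
    simp only [Ex]
    change 1 / 2 * Ex (S4 l) (fun ε => Φ (ε * fl a * fl b)) + _
      = 1 / 2 * Ex (S4 l) (fun ε => Φ (ε * fl a)) + _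
    by_cases hab : a = b
    · subst hab
      have : fl a * fl a = 1 := swap_mul_self _ _
      simp only [mul_assoc, this, mul_one]
      ring
    · have hb' : b ∈ l := by
        rcases List.mem_cons.1 hb with h | h
        · exact absurd h.symm hab
        · exact h
      have h1 := ih hb' (fun ε => Φ (ε * fl a))
      have h2 := ih hb' Φ
      have h3 : ∀ ε, ε * fl a * fl b = ε * fl b * fl a := by
        intro ε; rw [mul_assoc, fl_comm, ← mul_assoc]
      simp only [h3]
      rw [h1, h2]

end dbl

lemma fin3_perm : ∀ i j : Fin 3, i ≠ j → ∃ τ : Perm (Fin 3), τ 0 = i ∧ τ 2 = j := by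
  decide

/-- Doubling the number of positions. -/
lemma Sh.double {m N S M : ℕ} (hm : 3 ≤ m) (hS : Sh 3 3 S) (h3 : Sh 3 m N) (h1 : Sh 1 m M) :
    Sh 3 (2 * m) (S + 1 + N + M + m) := by
  classical
  let β := Fin m
  let α := β ⊕ β
  let φ : β ↪ α := Function.Embedding.inl
  let ψ : β ↪ α := Function.Embedding.inr
  let x' : Fin 3 → β := Fin.castLE hm
  have hx' : Function.Injective x' := Fin.castLE_injective hm
  let x : Fin 3 → α := φ ∘ x'
  have hx : Function.Injective x := φ.injective.comp hx'
  let b0 : β := x' 0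
  let s : Perm α := swap (x 2) (ψ b0)
  obtain ⟨LS, hLS, hVS, hUS⟩ := hS.symm x hx
  obtain ⟨L3, hL3, hV3, hU3⟩ := h3 β (by simp [β]) x' hx'
  obtain ⟨L1, hL1, hV1, hU1⟩ := h1 β (by simp [β]) (fun _ => b0)
    (Function.injective_of_subsingleton _)
  let l : List β := univ.toList
  have hl : ∀ b, b ∈ l := fun b => by simp [l]
  have hll : l.length = m := by simp [l, β]
  let E : (Fin 3 → α) → Prop := fun y => ∃ i j, i ≠ j ∧ pr (y i) = pr (y j)
  let PE : ℝ := 𝔼 ρ : Perm α, if E (ρ ∘ x) then (1:ℝ) else 0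
  let Q : Perm β → Prop := fun ρ => ρ b0 = x' 0 ∨ ρ b0 = x' 1
  let P2 : ℝ := 𝔼 ρ : Perm β, if Q ρ then (1:ℝ) else 0
  have hmR : (3:ℝ) ≤ m := by exact_mod_cast hm
  have hP2 : P2 = 2 / m := by
    have : ∀ ρ : Perm β, (if Q ρ then (1:ℝ) else 0)
        = (if ρ b0 = x' 0 then (1:ℝ) else 0) + (if ρ b0 = x' 1 then (1:ℝ) else 0) := by
      intro ρ
      have h01 : x' 0 ≠ x' 1 := fun h => by simpa using hx' h
      by_cases ha : ρ b0 = x' 0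
      · have hb : ρ b0 ≠ x' 1 := by rw [ha]; exact h01
        simp [Q, ha, h01]
      · simp [Q, ha]
    simp only [P2, this, expect_add_distrib, prob_point]
    simp only [β, Fintype.card_fin]
    ring
  have hP2pos : 0 < P2 := by rw [hP2]; positivity
  have hPE : PE ≤ P2 := by
    let c : α → α := Sum.swap
    have hcc : ∀ y, c y ≠ y := by rintro (y | y) <;> simp [c]
    have hcp : ∀ y z : α, y ≠ z → pr y = pr z → y = c z := by
      rintro (y | y) (z | z) hne h
      · exact absurd (congrArg Sum.inl h) hne
      · exact congrArg Sum.inl h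
      · exact congrArg Sum.inr h
      · exact absurd (congrArg Sum.inr h) hne
    have hle : ∀ ρ : Perm α, (if E (ρ ∘ x) then (1:ℝ) else 0)
        ≤ (if ρ (x 0) = c (ρ (x 1)) then (1:ℝ) else 0)
          + (if ρ (x 0) = c (ρ (x 2)) then (1:ℝ) else 0)
          + (if ρ (x 1) = c (ρ (x 2)) then (1:ℝ) else 0) := by
      intro ρ
      by_cases hE : E (ρ ∘ x)
      · have hor : ρ (x 0) = c (ρ (x 1)) ∨ ρ (x 0) = c (ρ (x 2)) ∨ ρ (x 1) = c (ρ (x 2)) := by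
          obtain ⟨i, j, hij, hp⟩ := hE
          have hinj := ρ.injective.comp hx
          have g1 := hcp _ _ (fun h => hij (hinj h)) hp
          have g2 := hcp _ _ (fun h => hij (hinj h).symm) hp.symm
          simp only [Function.comp_apply] at g1 g2
          fin_cases i <;> fin_cases j <;> simp at hij g1 g2 <;> tauto
        rw [if_pos hE]
        rcases hor with h | h | h <;> rw [if_pos h] <;> split_ifs <;> norm_num
      · rw [if_neg hE]
        split_ifs <;> norm_num
    have h01 : x 0 ≠ x 1 := fun h => by simpa using hx h
    have h02 : x 0 ≠ x 2 := fun h => by simpa using hx h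
    have h12 : x 1 ≠ x 2 := fun h => by simpa using hx h
    have := expect_le_expect (s := univ) (fun ρ _ => hle ρ)
    simp only [expect_add_distrib] at this
    rw [prob_partner c hcc _ _ h01, prob_partner c hcc _ _ h02, prob_partner c hcc _ _ h12] at this
    refine le_trans this ?_
    rw [hP2]
    have hcard : (Fintype.card α : ℝ) = 2 * m := by simp [α, β]; ring
    rw [hcard]
    have hpos : (0:ℝ) < 2 * m - 1 := by linarith
    rw [← add_div, ← add_div, div_le_div_iff₀ hpos (by linarith)]
    linarith
  let p : ℝ := PE / P2
  have hp0 : 0 ≤ p := div_nonneg (prob_nonneg _) hP2pos.le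
  have hp1 : p ≤ 1 := (div_le_one hP2pos).2 hPE
  refine Sh.of_one (α := α) (by simp [α, β]; ring) x hx
    (LS ++ ([(x 2, ψ b0, p)] ++ (mapL φ L3 ++ (mapL ψ L1 ++ S4 l)))) ?_ ?_ ?_
  · simp only [List.length_append, mapL_length, List.length_singleton, S4, List.length_map]; omega
  · refine VL_append hVS (VL_append (VL_single Sum.inl_ne_inr hp0 hp1)
      (VL_append (VL_mapL _ hV3) (VL_append (VL_mapL _ hV1) ?_)))
    intro e he
    simp only [S4, List.mem_map] at he
    obtain ⟨b, _, rfl⟩ := he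
    exact ⟨Sum.inl_ne_inr, by norm_num, by norm_num⟩
  intro G
  let Gb : (Fin 3 → α) → ℝ := fun y =>
    𝔼 τ : Perm (Fin 3), 𝔼 π : Perm β, Ex (S4 l) (fun ε => G (ε ∘ dbl π ∘ y ∘ τ))
  have invτ : ∀ y (τ : Perm (Fin 3)), Gb (y ∘ τ) = Gb y := fun y τ0 =>
    mean_mulLeft τ0 (fun τ => 𝔼 π : Perm β, Ex (S4 l) (fun ε => G (ε ∘ dbl π ∘ y ∘ τ)))
  have dbl_mul : ∀ π π' : Perm β, dbl (π * π') = dbl π * dbl π' := by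
    intro π π'
    ext y
    rcases y with y | y <;> rfl
  have invπ : ∀ y (π : Perm β), Gb (dbl π ∘ y) = Gb y := by
    intro y π0
    refine expect_congr rfl (fun τ _ => ?_)
    have := mean_mulRight π0 (fun π => Ex (S4 l) (fun ε => G (ε ∘ dbl π ∘ y ∘ τ)))
    rw [← this]
    simp only [dbl_mul]
    rfl
  have invf : ∀ y (b : β), Gb (fl b ∘ y) = Gb y := by
    intro y b
    refine expect_congr rfl (fun τ _ => ?_)
    refine expect_congr rfl (fun π _ => ?_)
    have := S4_inv l (π b) (hl _) (fun ε => G (ε ∘ dbl π ∘ y ∘ τ))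
    rw [← this]
    congr 1
    ext ε
    congr 1
    have h2 := dbl_fl π b
    ext i
    have h3 := congrArg (fun u : Perm α => u (y (τ i))) h2
    simp only [Perm.mul_apply] at h3
    simp only [Function.comp_apply, Perm.mul_apply]
    rw [h3]
  have mean : 𝔼 ρ : Perm α, Gb (ρ ∘ x) = 𝔼 ρ : Perm α, G (ρ ∘ x) := by
    simp only [Gb]
    rw [expect_comm]
    have : ∀ τ : Perm (Fin 3), 𝔼 ρ : Perm α, 𝔼 π : Perm β,
        Ex (S4 l) (fun ε => G (ε ∘ dbl π ∘ (ρ ∘ x) ∘ τ)) = 𝔼 ρ : Perm α, G (ρ ∘ x) := by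
      intro τ
      rw [expect_comm]
      have : ∀ π : Perm β, 𝔼 ρ : Perm α, Ex (S4 l) (fun ε => G (ε ∘ dbl π ∘ (ρ ∘ x) ∘ τ))
          = 𝔼 ρ : Perm α, G (ρ ∘ x) := by
        intro π
        rw [← Ex_expect]
        have : ∀ ε : Perm α, 𝔼 ρ : Perm α, G (ε ∘ dbl π ∘ (ρ ∘ x) ∘ τ)
            = 𝔼 ρ : Perm α, G (ρ ∘ x) := by
          intro ε
          rw [← mean_reindex hx τ G]
          exact mean_left (ε * dbl π) (x ∘ τ) G
        simp only [this, Ex_const]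
      simp only [this, Fintype.expect_const]
    simp only [this, Fintype.expect_const]
  -- normal forms
  have flat : ∀ y, ¬ E y → Gb y = Gb x := by
    intro y hE
    let g : Fin 3 → β := fun i => pr (y i)
    have hg : Function.Injective g := by
      intro i j hij
      by_contra hne
      exact hE ⟨i, j, hne, hij⟩
    have h : ∀ t : Finset (Fin 3),
        Gb (fun i => if i ∈ t then φ (g i) else y i) = Gb y := by
      intro t
      induction t using Finset.induction_on with
      | empty => simp
      | insert i t hi ih =>
        rw [← ih]
        rcases hyi : y i with b | b
        · congr 1
          ext j
          by_cases hj : j = i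
          · subst hj
            simp [hi, g, hyi, φ]
            rfl
          · simp [hj]
        · rw [← invf (fun i => if i ∈ t then φ (g i) else y i) b]
          congr 1
          have hgb : g i = b := by simp [g, hyi]
          ext j
          by_cases hj : j = i
          · subst hj
            simp [hi, hyi, φ, hgb]
            rfl
          · have hgj : g j ≠ b := fun h => hj (hg (h.trans hgb.symm))
            simp only [mem_insert, hj, false_or, Function.comp_apply]
            rw [fl_ne]
            split_ifs
            · exact hgj
            · exact hgj
    have h' := h univ
    simp only [mem_univ, if_true] at h'
    rw [← h']
    obtain ⟨π, hπ⟩ := ext_perm hx' hg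
    rw [← invπ x π]
    congr 1
    ext i
    rw [← hπ]
    rfl
  let yB : Fin 3 → α := ![φ (x' 0), φ (x' 1), ψ (x' 0)]
  have coll : ∀ y, Function.Injective y → E y → Gb y = Gb yB := by
    intro y0 hy0 hE
    obtain ⟨i, j, hij, hp⟩ := hE
    obtain ⟨τ, hτ0, hτ2⟩ := fin3_perm i j hij
    rw [← invτ y0 τ]
    have hy : Function.Injective (y0 ∘ τ) := hy0.comp τ.injective
    have hp' : pr ((y0 ∘ τ) 0) = pr ((y0 ∘ τ) 2) := by
      simp only [Function.comp_apply, hτ0, hτ2, hp]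
    generalize y0 ∘ τ = y at hy hp'
    have key : ∀ y : Fin 3 → α, Function.Injective y → ∀ a, y 0 = Sum.inl a → y 2 = Sum.inr a →
        Gb y = Gb yB := by
      have key2 : ∀ y : Fin 3 → α, ∀ a b, a ≠ b → y 0 = Sum.inl a → y 2 = Sum.inr a →
          y 1 = Sum.inl b → Gb y = Gb yB := by
        intro y a b hab h0 h2 h1
        have hi1 : Function.Injective (![x' 0, x' 1] : Fin 2 → β) := by
          intro i j h
          have h01 : x' 0 ≠ x' 1 := fun h => by simpa using hx' h
          fin_cases i <;> fin_cases j <;> simp at h ⊢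
          · exact h01 h
          · exact h01 h.symm
        have hi2 : Function.Injective (![a, b] : Fin 2 → β) := by
          intro i j h
          fin_cases i <;> fin_cases j <;> simp at h ⊢
          · exact hab h
          · exact hab h.symm
        obtain ⟨π, hπ⟩ := ext_perm hi1 hi2
        have e0 := congrFun hπ 0
        have e1 := congrFun hπ 1
        simp at e0 e1
        rw [← invπ yB π]
        congr 1
        ext i
        fin_cases i
        · simp only [Function.comp_apply, yB]
          exact h0.trans (congrArg Sum.inl e0.symm)
        · exact h1.trans (congrArg Sum.inl e1.symm)
        · exact h2.trans (congrArg Sum.inr e0.symm)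
      intro y hy a h0 h2
      have h10 : y 1 ≠ y 0 := fun h => by simpa using hy h
      have h12 : y 1 ≠ y 2 := fun h => by simpa using hy h
      rcases hy1 : y 1 with b | b
      · refine key2 y a b ?_ h0 h2 hy1
        rintro rfl
        exact h10 (hy1.trans h0.symm)
      · have hab : a ≠ b := by
          rintro rfl
          exact h12 (hy1.trans h2.symm)
        rw [← invf y b]
        refine key2 _ a b hab ?_ ?_ ?_
        · rw [Function.comp_apply, h0, fl_ne]; exact hab
        · rw [Function.comp_apply, h2, fl_ne]; exact hab
        · rw [Function.comp_apply, hy1, fl_inr]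
    have h02 : y 0 ≠ y 2 := fun h => by simpa using hy h
    rcases ha : y 0 with a | a <;> rcases hb : y 2 with b | b <;> rw [ha, hb] at hp' h02
    · exact absurd (congrArg Sum.inl hp') h02
    · refine key y hy a ha ?_
      rw [hb]; exact congrArg Sum.inr hp'.symm
    · have hab : a = b := hp'
      subst hab
      rw [← invf y a]
      refine key _ ((fl a).injective.comp hy) a ?_ ?_
      · rw [Function.comp_apply, ha, fl_inr]
      · rw [Function.comp_apply, hb, fl_inl]
    · exact absurd (congrArg Sum.inr hp') h02
  have val : ∀ y, Function.Injective y → Gb y = if E y then Gb yB else Gb x := by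
    intro y hy
    split_ifs with hE
    · exact coll y hy hE
    · exact flat y hE
  -- the left-hand side
  let K : (Fin 3 → α) → ℝ := fun y => Ex (S4 l) (fun ε => G (ε ∘ y))
  let T : (Fin 3 → α) → ℝ := fun y =>
    Ex L3 (fun σ => Ex L1 (fun ρ => K (via ψ ρ ∘ via φ σ ∘ y)))
  rw [Ex_append]
  have LHS : ∀ τ : Perm α, Ex ([(x 2, ψ b0, p)] ++ (mapL φ L3 ++ (mapL ψ L1 ++ S4 l)))
      (fun σ => G (⇑(σ * τ) ∘ x)) = (fun y => p * T (s ∘ y) + (1 - p) * T y) (τ ∘ x) := by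
    intro τ
    simp only [List.singleton_append, Ex, Ex_append, Ex_mapL]
    rfl
  simp only [LHS]
  rw [hUS (fun y => p * T (s ∘ y) + (1 - p) * T y)]
  have hφψ : ∀ b, φ b ∉ Set.range ψ := by rintro b ⟨a, ha⟩; exact Sum.inr_ne_inl ha
  have hψφ : ∀ b, ψ b ∉ Set.range φ := by rintro b ⟨a, ha⟩; exact Sum.inl_ne_inr ha
  have T1 : ∀ τ : Perm (Fin 3), T (x ∘ τ) = 𝔼 π : Perm β, K (dbl π ∘ x ∘ τ) := by
    intro τ
    have e : ∀ σ ρ : Perm β, via ψ ρ ∘ via φ σ ∘ x ∘ τ = dbl σ ∘ x ∘ τ := by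
      intro σ ρ
      ext i
      simp only [Function.comp_apply, x, via_apply]
      rw [via_apply_not _ _ _ (hφψ _)]
      rfl
    simp only [T, e, Ex_const]
    apply hU3.inv
    intro σ σ' h
    congr 1
    ext i
    exact congrArg φ (congrFun h (τ i))
  let W : Perm β → β → Fin 3 → α := fun σ b i => if i = 2 then ψ b else φ (σ (x' i))
  have hsx : ∀ i, s (x i) = if i = 2 then ψ b0 else x i := by
    intro i
    split_ifs with hi
    · rw [hi]; exact swap_apply_left _ _
    · exact swap_apply_of_ne_of_ne (fun h => hi (hx h)) Sum.inl_ne_inr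
  have T2 : ∀ τ : Perm (Fin 3), T (s ∘ x ∘ τ)
      = 𝔼 π : Perm β, 𝔼 ρ : Perm β, K (dbl π ∘ W 1 (ρ b0) ∘ τ) := by
    intro τ
    have e : ∀ σ ρ : Perm β, via ψ ρ ∘ via φ σ ∘ s ∘ x ∘ τ = W σ (ρ b0) ∘ τ := by
      intro σ ρ
      ext i
      simp only [Function.comp_apply, W, hsx]
      split_ifs with hi
      · rw [via_apply_not _ _ _ (hψφ _), via_apply]
      · rw [show x (τ i) = φ (x' (τ i)) from rfl, via_apply, via_apply_not _ _ _ (hφψ _)]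
    simp only [T, e]
    have e1 : ∀ σ : Perm β, Ex L1 (fun ρ => K (W σ (ρ b0) ∘ τ))
        = 𝔼 ρ : Perm β, K (W σ (ρ b0) ∘ τ) := by
      intro σ
      apply hU1.inv
      intro ρ ρ' h
      have := congrFun h 0
      simp only [Function.comp_apply] at this
      rw [this]
    simp only [e1]
    rw [hU3.inv]
    · refine expect_congr rfl (fun σ _ => ?_)
      rw [← mean_mulLeft σ (fun ρ => K (W σ (ρ b0) ∘ τ))]
      refine expect_congr rfl (fun ρ _ => ?_)
      congr 1
      ext i
      simp only [Function.comp_apply, W, Perm.mul_apply]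
      split_ifs <;> rfl
    · intro σ σ' h
      have : ∀ b, W σ b = W σ' b := by
        intro b
        ext i
        have := congrFun h i
        simp only [Function.comp_apply] at this
        simp only [W, this]
      simp only [this]
  simp only [T1, T2, expect_add_distrib, ← mul_expect]
  have hA : 𝔼 τ : Perm (Fin 3), 𝔼 π : Perm β, K (dbl π ∘ x ∘ τ) = Gb x := rfl
  have hB : 𝔼 τ : Perm (Fin 3), 𝔼 π : Perm β, 𝔼 ρ : Perm β, K (dbl π ∘ W 1 (ρ b0) ∘ τ)
      = 𝔼 ρ : Perm β, Gb (W 1 (ρ b0)) := by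
    have : ∀ τ : Perm (Fin 3), 𝔼 π : Perm β, 𝔼 ρ : Perm β, K (dbl π ∘ W 1 (ρ b0) ∘ τ)
      = 𝔼 ρ : Perm β, 𝔼 π : Perm β, K (dbl π ∘ W 1 (ρ b0) ∘ τ) := fun τ => expect_comm _ _ _
    simp only [this]
    rw [expect_comm]
  rw [hA, hB]
  have hW : ∀ ρ : Perm β, Gb (W 1 (ρ b0)) = if Q ρ then Gb yB else Gb x := by
    intro ρ
    have w0 : W 1 (ρ b0) 0 = φ (x' 0) := rfl
    have w1 : W 1 (ρ b0) 1 = φ (x' 1) := rfl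
    have w2 : W 1 (ρ b0) 2 = ψ (ρ b0) := rfl
    have n01 : x' 0 ≠ x' 1 := fun h => by simpa using hx' h
    have hinj : Function.Injective (W 1 (ρ b0)) := by
      intro i j h
      by_cases hi : i = 2 <;> by_cases hj : j = 2
      · rw [hi, hj]
      · simp only [W, hi, hj, if_true, if_false] at h
        exact absurd h Sum.inr_ne_inl
      · simp only [W, hi, hj, if_true, if_false] at h
        exact absurd h Sum.inl_ne_inr
      · simp only [W, hi, hj, if_false] at h
        exact hx' (φ.injective h)
    rw [val _ hinj]
    have hiff : E (W 1 (ρ b0)) ↔ Q ρ := by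
      constructor
      · rintro ⟨i, j, hij, hp⟩
        have p0 : pr (W 1 (ρ b0) 0) = x' 0 := rfl
        have p1 : pr (W 1 (ρ b0) 1) = x' 1 := rfl
        have p2 : pr (W 1 (ρ b0) 2) = ρ b0 := rfl
        have n10 := n01.symm
        fin_cases i <;> fin_cases j <;>
          simp only [Fin.zero_eta, Fin.mk_one, Fin.reduceFinMk, p0, p1, p2] at hij hp
        · exact absurd rfl hij
        · exact absurd hp n01
        · exact Or.inl hp.symm
        · exact absurd hp n10
        · exact absurd rfl hij
        · exact Or.inr hp.symm
        · exact Or.inl hp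
        · exact Or.inr hp
        · exact absurd rfl hij
      · rintro (h | h)
        · exact ⟨2, 0, by decide, h⟩
        · exact ⟨2, 1, by decide, h⟩
    by_cases hQ : Q ρ
    · rw [if_pos hQ, if_pos (hiff.2 hQ)]
    · rw [if_neg hQ, if_neg (fun h => hQ (hiff.1 h))]
  rw [expect_congr rfl (fun ρ _ => hW ρ), mean_two Q, ← mean]
  have : ∀ ρ : Perm α, Gb (ρ ∘ x) = if E (ρ ∘ x) then Gb yB else Gb x :=
    fun ρ => val _ (ρ.injective.comp hx)
  rw [expect_congr rfl (fun ρ _ => this ρ), mean_two (fun ρ : Perm α => E (ρ ∘ x))]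
  change p * (Gb x + P2 * (Gb yB - Gb x)) + (1 - p) * Gb x = Gb x + PE * (Gb yB - Gb x)
  have hpp : p * P2 = PE := div_mul_cancel₀ _ hP2pos.ne'
  rw [← hpp]
  ring

lemma sh_one : ∀ n, 1 ≤ n → Sh 1 n (n - 1) := by
  intro n hn
  induction n, hn using Nat.le_induction with
  | base => exact Sh.one_one
  | succ n hn ih =>
    exact (Sh.succ (t := 0) Sh.one_one ih hn).mono (by omega)

lemma sh_two (n : ℕ) (hn : 2 ≤ n) : Sh 2 n (n - 1 + (n - 2)) :=
  (Sh.comp (s := 1) (t := 1) (sh_one n (by omega)) (sh_one (n - 1) (by omega))).mono (by omega)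

lemma sh_three_three : Sh 3 3 3 :=
  (Sh.comp (s := 1) (t := 2) (sh_one 3 (by omega)) (sh_two (3 - 1) (by omega))).mono (by omega)

lemma sh_three : ∀ n, 3 ≤ n → Sh 3 n (2 * n + 7 * Nat.log 2 n) := by
  intro n
  induction n using Nat.strong_induction_on with
  | _ n ih =>
    intro hn
    by_cases h6 : n < 6
    · have s4 : Sh 3 4 7 := Sh.succ (t := 2) sh_three_three sh_three_three (by omega)
      have s5 : Sh 3 5 11 := Sh.succ (t := 2) sh_three_three s4 (by omega)
      have hlog : 1 ≤ Nat.log 2 n := Nat.log_pos (by norm_num) (by omega)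
      interval_cases n
      · exact sh_three_three.mono (by omega)
      · exact s4.mono (by omega)
      · exact s5.mono (by omega)
    · obtain ⟨m, hm⟩ : ∃ m, m = n / 2 := ⟨_, rfl⟩
      have hlog : Nat.log 2 n = Nat.log 2 m + 1 := by
        rw [hm, Nat.log_of_one_lt_of_le (by norm_num) (by omega)]
      have hm3 : 3 ≤ m := by omega
      have hd := Sh.double hm3 sh_three_three (ih m (by omega) hm3) (sh_one m (by omega))
      rcases Nat.even_or_odd' n with ⟨k, hk | hk⟩
      · have : n = 2 * m := by omega
        rw [hlog, this]
        exact hd.mono (by omega)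
      · have : n = 2 * m + 1 := by omega
        rw [hlog, this]
        exact (Sh.succ (t := 2) sh_three_three hd (by omega)).mono (by omega)

lemma sh_small (r n : ℕ) (hr : r < 3) (hn : r ≤ n) : Sh r n (r * n) := by
  interval_cases r
  · exact (Sh.zero n).mono (by omega)
  · exact (sh_one n hn).mono (by omega)
  · exact (sh_two n hn).mono (by omega)

lemma sh_all (l r : ℕ) (hr : r < 3) : ∀ n, 3 * l + r ≤ n →
    Sh (3 * l + r) n ((2 * l + r) * n + 7 * l * Nat.log 2 n) := by
  induction l with
  | zero =>
    intro n hn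
    simpa using sh_small r n hr (by omega)
  | succ l ih =>
    intro n hn
    have h1 := sh_three n (by omega)
    have h2 := ih (n - 3) (by omega)
    have h3 := Sh.comp h1 h2
    rw [show 3 * (l + 1) + r = 3 + (3 * l + r) by ring]
    refine h3.mono ?_
    have hlog : Nat.log 2 (n - 3) ≤ Nat.log 2 n := Nat.log_mono_right (by omega)
    have e1 : (2 * l + r) * (n - 3) ≤ (2 * l + r) * n := Nat.mul_le_mul_left _ (by omega)
    have e2 : 7 * l * Nat.log 2 (n - 3) ≤ 7 * l * Nat.log 2 n := Nat.mul_le_mul_left _ hlog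
    nlinarith

lemma Ex_eq_sum {n : ℕ} (L : List (LazyT n)) (Φ : Perm (Fin n) → ℝ) :
    Ex L Φ = ∑ σ, permDist L σ * Φ σ := by
  induction L generalizing Φ with
  | nil => simp [Ex, permDist]
  | cons e L ih =>
    simp only [Ex, permDist, ih, add_mul, sum_add_distrib, mul_sum, mul_assoc]
    congr 1
    refine Fintype.sum_equiv (Equiv.mulRight (swap e.1 e.2.1)) _ _ ?_
    intro σ
    simp [mul_assoc]

lemma placement_prob {t n : ℕ} (ht : t ≤ n) (f : Fin t → Fin n) (hf : Function.Injective f) :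
    (𝔼 ρ : Perm (Fin n), if (ρ ∘ Fin.castLE ht) = f then (1:ℝ) else 0)
      = ((n - t).factorial : ℝ) / (n.factorial : ℝ) := by
  have hx : Function.Injective (Fin.castLE ht) := Fin.castLE_injective ht
  have hc : ∀ g : Fin t ↪ Fin n,
      (𝔼 ρ : Perm (Fin n), if (ρ ∘ Fin.castLE ht) = g then (1:ℝ) else 0)
      = 𝔼 ρ : Perm (Fin n), if (ρ ∘ Fin.castLE ht) = f then (1:ℝ) else 0 := by
    intro g
    obtain ⟨u, hu⟩ := ext_perm hf g.injective
    rw [← mean_left u (Fin.castLE ht) (fun y => if y = g then (1:ℝ) else 0)]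
    refine expect_congr rfl (fun ρ _ => ?_)
    congr 1
    rw [← hu]
    exact propext u.injective.comp_left.eq_iff
  have hs : ∑ g : Fin t ↪ Fin n,
      (𝔼 ρ : Perm (Fin n), if (ρ ∘ Fin.castLE ht) = g then (1:ℝ) else 0) = 1 := by
    rw [← expect_sum_comm]
    have : ∀ ρ : Perm (Fin n), ∑ g : Fin t ↪ Fin n,
        (if (ρ ∘ Fin.castLE ht) = g then (1:ℝ) else 0) = 1 := by
      intro ρ
      rw [sum_eq_single (⟨ρ ∘ Fin.castLE ht, ρ.injective.comp hx⟩ : Fin t ↪ Fin n)]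
      · simp
      · intro g _ hg
        rw [if_neg]
        intro h
        apply hg
        ext i
        simp [← h]
      · intro h; exact absurd (mem_univ _) h
    simp only [this, Fintype.expect_const]
  simp only [hc, sum_const, card_univ, nsmul_eq_mul, Fintype.card_embedding_eq,
    Fintype.card_fin] at hs
  have hd := Nat.factorial_mul_descFactorial ht
  have hd' : ((n - t).factorial : ℝ) * (n.descFactorial t : ℝ) = n.factorial := by
    exact_mod_cast hd
  have h1 : (n.factorial : ℝ) ≠ 0 := by exact_mod_cast n.factorial_ne_zero
  rw [eq_div_iff h1, ← hd']
  calc _ = ((n - t).factorial : ℝ) * ((n.descFactorial t : ℝ) * _) := by ring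
    _ = _ := by rw [hs, mul_one]

lemma Sh.Ut_le {t n N : ℕ} (ht : t ≤ n) (h : Sh t n N) : Ut t n ≤ N := by
  obtain ⟨L, hL, hV, hU⟩ := h (Fin n) (by simp) (Fin.castLE ht) (Fin.castLE_injective ht)
  refine le_trans (Nat.sInf_le ⟨ht, L, rfl, hV, ?_⟩) hL
  intro f hf
  rw [← placement_prob ht f hf, ← hU (fun y => if y = f then (1:ℝ) else 0), Ex_eq_sum]
  unfold placeProb
  refine sum_congr rfl (fun σ _ => ?_)
  simp only [mul_ite, mul_one, mul_zero]
  refine if_congr ?_ rfl rfl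
  rw [funext_iff]
  rfl

end Shf

theorem Ut_fixed_t_linear (l r : ℕ) (hr : r < 3) (ht : 1 ≤ 3 * l + r) :
    ∃ C : ℝ, 0 < C ∧ ∀ n : ℕ, max (3 * l + r) 2 ≤ n →
      (Ut (3 * l + r) n : ℝ) ≤ (2 * (l : ℝ) + r) * n + C * Real.log n := by
  have hlog2 : 0 < Real.log 2 := Real.log_pos (by norm_num)
  refine ⟨7 * l / Real.log 2 + 1, by positivity, ?_⟩
  intro n hn
  have hn1 : 3 * l + r ≤ n := le_trans (le_max_left _ _) hn
  have hn2 : 2 ≤ n := le_trans (le_max_right _ _) hn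
  have h := (Shf.sh_all l r hr n hn1).Ut_le hn1
  have h' : (Ut (3 * l + r) n : ℝ) ≤ (2 * (l : ℝ) + r) * n + 7 * l * (Nat.log 2 n : ℝ) := by
    exact_mod_cast h
  have hlogn : 0 ≤ Real.log n := Real.log_nonneg (by exact_mod_cast (by omega : 1 ≤ n))
  have hle : (Nat.log 2 n : ℝ) ≤ Real.log n / Real.log 2 := by
    rw [le_div_iff₀ hlog2, ← Real.log_pow]
    apply Real.log_le_log (by positivity)
    exact_mod_cast Nat.pow_log_le_self 2 (by omega)
  have h3 : 7 * (l : ℝ) * (Nat.log 2 n : ℝ) ≤ 7 * l * (Real.log n / Real.log 2) :=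
    mul_le_mul_of_nonneg_left hle (by positivity)
  calc _ ≤ _ := h'
    _ ≤ (2 * (l : ℝ) + r) * n + (7 * l * (Real.log n / Real.log 2) + Real.log n) := by linarith
    _ = _ := by ring
end

section
/- For every integer ℓ ≥ 0 and every integer r with 0 ≤ r < 3 such that t = 4ℓ + r ≥ 1, there exists a constant C > 0 (depending only on ℓ and r) such that for all integers n ≥ max(t, 2), Ũ_t(n) ≤ (7ℓ/2 + r)·n + C·log n. -/
open scoped BigOperators

namespace Shf

open Equiv Finset

/-- group algebra of the symmetric group -/
abbrev RA (n : ℕ) := MonoidAlgebra ℝ (Perm (Fin n))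

variable {n : ℕ}

noncomputable def δ (σ : Perm (Fin n)) : RA n := MonoidAlgebra.single σ 1

lemma δ_mul (σ τ : Perm (Fin n)) : δ σ * δ τ = δ (σ * τ) := by
  simp [δ, MonoidAlgebra.single_mul_single]

lemma δ_mul_assoc (σ τ : Perm (Fin n)) (x : RA n) : δ σ * (δ τ * x) = δ (σ * τ) * x := by
  rw [← mul_assoc, δ_mul]

lemma δ_one : (δ 1 : RA n) = 1 := rfl

/-- permutations supported in `W` -/
def Sy (W : Finset (Fin n)) : Finset (Perm (Fin n)) :=
  univ.filter (fun σ => ∀ x, x ∉ W → σ x = x)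

lemma mem_Sy {W : Finset (Fin n)} {σ : Perm (Fin n)} : σ ∈ Sy W ↔ ∀ x, x ∉ W → σ x = x := by
  simp [Sy]

lemma one_Sy (W : Finset (Fin n)) : (1 : Perm (Fin n)) ∈ Sy W := by simp [mem_Sy]

lemma mul_Sy {W : Finset (Fin n)} {σ τ : Perm (Fin n)} (hs : σ ∈ Sy W) (ht : τ ∈ Sy W) :
    σ * τ ∈ Sy W := by
  rw [mem_Sy] at *
  intro x hx
  rw [Perm.mul_apply, ht x hx, hs x hx]

lemma inv_Sy {W : Finset (Fin n)} {σ : Perm (Fin n)} (hs : σ ∈ Sy W) : σ⁻¹ ∈ Sy W := by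
  rw [mem_Sy] at *
  intro x hx
  rw [Perm.inv_eq_iff_eq, hs x hx]

lemma Sy_mono {W W' : Finset (Fin n)} (h : W ⊆ W') {σ : Perm (Fin n)} (hs : σ ∈ Sy W) :
    σ ∈ Sy W' := by
  rw [mem_Sy] at *
  exact fun x hx => hs x (fun h' => hx (h h'))

lemma swap_Sy {W : Finset (Fin n)} {a b : Fin n} (ha : a ∈ W) (hb : b ∈ W) : swap a b ∈ Sy W := by
  rw [mem_Sy]
  intro x hx
  apply swap_apply_of_ne_of_ne <;> rintro rfl <;> contradiction

lemma Sy_apply_mem {W : Finset (Fin n)} {σ : Perm (Fin n)} (hs : σ ∈ Sy W) {x : Fin n} :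
    σ x ∈ W ↔ x ∈ W := by
  rw [mem_Sy] at hs
  constructor
  · intro h
    by_contra hx
    rw [hs x hx] at h
    exact hx h
  · intro h
    by_contra hx
    have := hs _ hx
    have := σ.injective this
    rw [this] at hx
    exact hx h

/-- uniform average over permutations supported in `W` -/
noncomputable def e (W : Finset (Fin n)) : RA n := ((#(Sy W) : ℝ))⁻¹ • ∑ σ ∈ Sy W, δ σ

lemma Sy_card_ne (W : Finset (Fin n)) : (#(Sy W) : ℝ) ≠ 0 := by
  have : 0 < #(Sy W) := card_pos.mpr ⟨1, one_Sy W⟩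
  positivity

lemma δ_e {W : Finset (Fin n)} {σ : Perm (Fin n)} (hs : σ ∈ Sy W) : δ σ * e W = e W := by
  unfold e
  rw [mul_smul_comm, mul_sum]
  congr 1
  simp_rw [δ_mul]
  refine sum_bij' (fun τ _ => σ * τ) (fun τ _ => σ⁻¹ * τ) ?_ ?_ ?_ ?_ ?_
  · intro τ ht; exact mul_Sy hs ht
  · intro τ ht; exact mul_Sy (inv_Sy hs) ht
  · simp
  · simp
  · simp

lemma e_δ {W : Finset (Fin n)} {σ : Perm (Fin n)} (hs : σ ∈ Sy W) : e W * δ σ = e W := by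
  unfold e
  rw [smul_mul_assoc, sum_mul]
  congr 1
  simp_rw [δ_mul]
  refine sum_bij' (fun τ _ => τ * σ) (fun τ _ => τ * σ⁻¹) ?_ ?_ ?_ ?_ ?_
  · intro τ ht; exact mul_Sy ht hs
  · intro τ ht; exact mul_Sy ht (inv_Sy hs)
  · simp
  · simp
  · simp

lemma e_mul_of_inv {W : Finset (Fin n)} {x : RA n} (h : ∀ σ ∈ Sy W, δ σ * x = x) :
    e W * x = x := by
  unfold e
  rw [smul_mul_assoc, sum_mul, sum_congr rfl h, sum_const, ← Nat.cast_smul_eq_nsmul ℝ, smul_smul,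
    inv_mul_cancel₀ (Sy_card_ne W), one_smul]

lemma mul_e_of_inv {W : Finset (Fin n)} {x : RA n} (h : ∀ σ ∈ Sy W, x * δ σ = x) :
    x * e W = x := by
  unfold e
  rw [mul_smul_comm, mul_sum, sum_congr rfl h, sum_const, ← Nat.cast_smul_eq_nsmul ℝ, smul_smul,
    inv_mul_cancel₀ (Sy_card_ne W), one_smul]

lemma e_mul_e {K W : Finset (Fin n)} (h : K ⊆ W) : e K * e W = e W :=
  e_mul_of_inv fun _ hs => δ_e (Sy_mono h hs)

lemma e_mul_e' {K W : Finset (Fin n)} (h : K ⊆ W) : e W * e K = e W :=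
  mul_e_of_inv fun _ hs => e_δ (Sy_mono h hs)

lemma e_empty : (e ∅ : RA n) = 1 := by
  have : Sy (∅ : Finset (Fin n)) = {1} := by
    ext σ
    simp only [mem_Sy, mem_singleton]
    constructor
    · intro h; ext x; simp [h x]
    · rintro rfl; simp
  simp [e, this, δ_one]

lemma δ_e_comm (σ : Perm (Fin n)) (W : Finset (Fin n)) :
    δ σ * e W = e (W.image σ) * δ σ := by
  have hc : ∀ τ, τ ∈ Sy W ↔ σ * τ * σ⁻¹ ∈ Sy (W.image σ) := by
    intro τ
    simp only [mem_Sy]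
    constructor
    · intro h x hx
      have : σ⁻¹ x ∉ W := by
        intro hh; apply hx; exact mem_image.mpr ⟨_, hh, by simp⟩
      rw [Perm.mul_apply, Perm.mul_apply, h _ this]; simp
    · intro h x hx
      have : σ x ∉ W.image σ := by
        intro hh
        obtain ⟨y, hy, hy'⟩ := mem_image.mp hh
        exact hx (σ.injective hy' ▸ hy)
      have := h _ this
      simpa [Perm.mul_apply] using this
  have hcard : #(Sy W) = #(Sy (W.image σ)) := by
    refine card_bij' (fun τ _ => σ * τ * σ⁻¹) (fun τ _ => σ⁻¹ * τ * σ) ?_ ?_ ?_ ?_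
    · intro τ ht; exact (hc τ).mp ht
    · intro τ ht; rw [hc]; convert ht using 1; group
    · intro τ ht; group
    · intro τ ht; group
  unfold e
  rw [mul_smul_comm, smul_mul_assoc, hcard]
  congr 1
  rw [mul_sum, sum_mul]
  simp_rw [δ_mul]
  refine sum_bij' (fun τ _ => σ * τ * σ⁻¹) (fun τ _ => σ⁻¹ * τ * σ) ?_ ?_ ?_ ?_ ?_
  · intro τ ht; exact (hc τ).mp ht
  · intro τ ht; rw [hc]; convert ht using 1; group
  · intro τ ht; group
  · intro τ ht; group
  · intro τ ht; congr 1; group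

lemma commute_e {W : Finset (Fin n)} {x : RA n} (h : ∀ σ ∈ Sy W, Commute (δ σ) x) :
    Commute (e W) x := by
  unfold e
  exact (Commute.sum_left _ _ _ h).smul_left _

lemma δ_commute_e {W : Finset (Fin n)} {σ : Perm (Fin n)} (h : ∀ x ∈ W, σ x = x) :
    Commute (δ σ) (e W) := by
  unfold Commute SemiconjBy
  rw [δ_e_comm]
  congr 2
  ext x
  simp only [mem_image]
  constructor
  · rintro ⟨a, ha, rfl⟩; rwa [h a ha]
  · intro hx; exact ⟨x, hx, h x hx⟩

lemma e_commute_e {W W' : Finset (Fin n)} (h : Disjoint W W') : Commute (e W) (e W') := by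
  apply commute_e
  intro σ hs
  apply δ_commute_e
  intro x hx
  rw [mem_Sy] at hs
  exact hs x (fun hh => (Finset.disjoint_left.mp h hh hx))

/-- element of the group algebra of a lazy transposition -/
noncomputable def lz (a b : Fin n) (p : ℝ) : RA n := p • δ (swap a b) + (1 - p) • 1

noncomputable def xl : List (LazyT n) → RA n
  | [] => 1
  | t :: L => xl L * lz t.1 t.2.1 t.2.2

lemma coeff_xl (L : List (LazyT n)) (σ : Perm (Fin n)) : (xl L).coeff σ = permDist L σ := by
  induction L generalizing σ with
  | nil =>
    simp only [xl, permDist, MonoidAlgebra.one_def]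
    rw [MonoidAlgebra.coeff_single, Finsupp.single_apply]
    simp [eq_comm]
  | cons t L ih =>
    simp only [xl, permDist, lz, mul_add, mul_smul_comm, mul_one]
    rw [MonoidAlgebra.coeff_add, Finsupp.add_apply, MonoidAlgebra.coeff_smul_apply,
      MonoidAlgebra.coeff_smul_apply, ih, δ, MonoidAlgebra.coeff_mul_single_apply, ih]
    simp

lemma xl_append (L1 L2 : List (LazyT n)) : xl (L1 ++ L2) = xl L2 * xl L1 := by
  induction L1 with
  | nil => simp [xl]
  | cons t L ih => simp [xl, ih, mul_assoc]

/-- `x` is realised by at most `k` star transpositions with hub `h` -/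
def Rl (h : Fin n) (k : ℝ) (x : RA n) : Prop :=
  ∃ L : List (LazyT n), (∀ t ∈ L, t.Valid ∧ t.1 = h) ∧ (L.length : ℝ) ≤ k ∧ xl L = x

variable {h : Fin n}

lemma Rl.mono {k k' : ℝ} {x : RA n} (hx : Rl h k x) (hk : k ≤ k') : Rl h k' x := by
  obtain ⟨L, h1, h2, h3⟩ := hx
  exact ⟨L, h1, h2.trans hk, h3⟩

lemma Rl.one : Rl h 0 1 := ⟨[], by simp, by simp, rfl⟩

lemma Rl.mul {k k' : ℝ} {x y : RA n} (hx : Rl h k x) (hy : Rl h k' y) :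
    Rl h (k + k') (x * y) := by
  obtain ⟨L, h1, h2, h3⟩ := hx
  obtain ⟨L', h1', h2', h3'⟩ := hy
  refine ⟨L' ++ L, ?_, ?_, ?_⟩
  · intro t ht
    rcases List.mem_append.mp ht with ht | ht
    · exact h1' t ht
    · exact h1 t ht
  · push_cast [List.length_append]; linarith
  · rw [xl_append, h3, h3']

lemma Rl.lz {b : Fin n} (hb : b ≠ h) {p : ℝ} (h0 : 0 ≤ p) (h1 : p ≤ 1) : Rl h 1 (lz h b p) :=
  ⟨[(h, b, p)], by simp [LazyT.Valid, hb.symm, h0, h1], by simp, by simp [xl]⟩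

lemma lz_one (a b : Fin n) : lz a b 1 = δ (swap a b) := by simp [lz]

lemma Rl.swap {b : Fin n} (hb : b ≠ h) : Rl h 1 (δ (swap h b)) := by
  rw [← lz_one]
  exact Rl.lz hb zero_le_one le_rfl

lemma lz_comm (a b : Fin n) (p : ℝ) : Shf.lz a b p = Shf.lz b a p := by
  simp [Shf.lz, swap_comm]

lemma swap_conj {a b c : Fin n} (hab : a ≠ b) (hbc : b ≠ c) (hac : a ≠ c) :
    swap a b * swap a c * swap a b = swap b c := by
  have := Equiv.swap_mul_swap_mul_swap (x := c) (y := a) (z := b) hac.symm hbc.symm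
  rw [swap_comm a c, this]

/-- simulation of an arbitrary lazy transposition -/
lemma Rl.any {a b : Fin n} (hab : a ≠ b) {p : ℝ} (h0 : 0 ≤ p) (h1 : p ≤ 1) :
    Rl h 3 (Shf.lz a b p) := by
  by_cases ha : a = h
  · subst ha; exact (Rl.lz hab.symm h0 h1).mono (by norm_num)
  by_cases hb : b = h
  · subst hb; rw [lz_comm]; exact (Rl.lz hab h0 h1).mono (by norm_num)
  have : Shf.lz a b p = δ (Equiv.swap h a) * Shf.lz h b p * δ (Equiv.swap h a) := by
    simp only [Shf.lz, mul_add, add_mul, mul_smul_comm, smul_mul_assoc, δ_mul, mul_one]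
    rw [swap_conj (Ne.symm ha) hab (Ne.symm hb)]
    simp [δ_one]
  rw [this]
  exact (((Rl.swap ha).mul (Rl.lz hb h0 h1)).mul (Rl.swap ha)).mono (by norm_num)

end Shf

namespace Shf

open Equiv Finset

variable {n : ℕ} {h : Fin n}

/-- `Z` can be mixed into `V` with `k` star transpositions -/
def G (h : Fin n) (V Z : Finset (Fin n)) (k : ℝ) : Prop :=
  ∃ x, Rl h k x ∧ x * e (V \ Z) = e V

lemma G.mono {V Z : Finset (Fin n)} {k k' : ℝ} (hG : G h V Z k) (hk : k ≤ k') : G h V Z k' := by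
  obtain ⟨x, h1, h2⟩ := hG
  exact ⟨x, h1.mono hk, h2⟩

lemma G.empty (V : Finset (Fin n)) : G h V ∅ 0 := ⟨1, Rl.one, by simp⟩

lemma G.batch {V Z Y : Finset (Fin n)} {k1 k2 : ℝ} (hY : Y ⊆ Z)
    (h1 : G h (V \ Y) (Z \ Y) k1) (h2 : G h V Y k2) : G h V Z (k1 + k2) := by
  obtain ⟨x1, r1, e1⟩ := h1
  obtain ⟨x2, r2, e2⟩ := h2
  refine ⟨x2 * x1, (r2.mul r1).mono (by linarith), ?_⟩
  have : (V \ Y) \ (Z \ Y) = V \ Z := by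
    ext a
    simp only [mem_sdiff]
    have := @hY a
    tauto
  rw [this] at e1
  rw [mul_assoc, e1, e2]

lemma G.conj {V Z : Finset (Fin n)} {z : Fin n} (hz : z ≠ h) {k : ℝ}
    (hG : G h (V.image (swap h z)) (Z.image (swap h z)) k) : G h V Z (k + 2) := by
  obtain ⟨x, r, hx⟩ := hG
  refine ⟨δ (swap h z) * x * δ (swap h z), (((Rl.swap hz).mul r).mul (Rl.swap hz)).mono
    (by linarith), ?_⟩
  rw [mul_assoc, δ_e_comm, image_sdiff _ _ (swap h z).injective, ← mul_assoc, mul_assoc (δ _) x,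
    hx, δ_e_comm, mul_assoc, δ_mul, swap_mul_self, δ_one, mul_one]
  congr 1
  rw [image_image]
  ext a; simp

lemma Sy_sdiff {W F : Finset (Fin n)} {σ : Perm (Fin n)} (hs : σ ∈ Sy W) (hF : ∀ x ∈ F, σ x = x) :
    σ ∈ Sy (W \ F) := by
  rw [mem_Sy] at *
  intro x hx
  by_cases h1 : x ∈ W
  · apply hF
    by_contra h2
    exact hx (mem_sdiff.mpr ⟨h1, h2⟩)
  · exact hs x h1

lemma δ_eq_of {g g' : Perm (Fin n)} {E : RA n} (hh : δ (g⁻¹ * g') * E = E) :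
    δ g' * E = δ g * E := by
  have : δ g' * E = δ g * (δ (g⁻¹ * g') * E) := by
    rw [← mul_assoc, δ_mul]; simp
  rw [this, hh]

lemma coset_term {W : Finset (Fin n)} (hW : h ∈ W) {σ : Perm (Fin n)} (hs : σ ∈ Sy W) {v : Fin n}
    (hv : v ∈ W) :
    δ σ * (δ (swap h v) * e (W \ {h})) = δ (swap h (σ v)) * e (W \ {h}) := by
  rw [δ_mul_assoc]
  apply δ_eq_of
  apply δ_e
  apply Sy_sdiff
  · exact mul_Sy (inv_Sy (swap_Sy hW ((Sy_apply_mem hs).mpr hv))) (mul_Sy hs (swap_Sy hW hv))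
  · simp

lemma coset_formula {W : Finset (Fin n)} (hW : h ∈ W) :
    (#W : ℝ) • e W = ∑ v ∈ W, δ (swap h v) * e (W \ {h}) := by
  have h1 : e W * (∑ v ∈ W, δ (swap h v) * e (W \ {h})) =
      ∑ v ∈ W, δ (swap h v) * e (W \ {h}) := by
    apply e_mul_of_inv
    intro σ hs
    rw [mul_sum, sum_congr rfl (fun v hv => coset_term hW hs hv)]
    refine sum_bij' (fun v _ => σ v) (fun v _ => σ⁻¹ v) ?_ ?_ ?_ ?_ ?_
    · intro v hv; exact (Sy_apply_mem hs).mpr hv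
    · intro v hv; exact (Sy_apply_mem (inv_Sy hs)).mpr hv
    · simp
    · simp
    · simp
  rw [← h1, mul_sum]
  rw [sum_congr rfl (g := fun _ => e W)]
  · rw [sum_const, Nat.cast_smul_eq_nsmul]
  · intro v hv
    rw [← mul_assoc, e_δ (swap_Sy hW hv), e_mul_e' sdiff_subset]

lemma pass_aux {W : Finset (Fin n)} (hW : h ∈ W) (T : Finset (Fin n)) (hT : T ⊆ W \ {h}) :
    ∃ x, Rl h (#T) x ∧
      (x * e (W \ {h}) = ((#T : ℝ) + 1)⁻¹ • ∑ v ∈ insert h T, δ (swap h v) * e (W \ {h})) ∧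
      ∀ v ∈ W, v ≠ h → v ∉ T →
        x * (δ (swap h v) * e (W \ {h})) = δ (swap h v) * e (W \ {h}) := by
  induction T using Finset.induction_on with
  | empty =>
    refine ⟨1, by simpa using Rl.one, ?_, ?_⟩
    · simp [← Equiv.Perm.one_def, δ_one]
    · simp
  | insert v T hv ih =>
    obtain ⟨x, hr, h1, h2⟩ := ih (fun a ha => hT (mem_insert_of_mem ha))
    have hvW := mem_sdiff.mp (hT (mem_insert_self v T))
    have hvh : v ≠ h := by simpa using hvW.2
    have hp : (0 : ℝ) < (#T : ℝ) + 2 := by positivity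
    have hhT : h ∉ T := fun hh => by
      have := hT (mem_insert_of_mem hh)
      simp at this
    refine ⟨x * lz h v ((#T : ℝ) + 2)⁻¹, ?_, ?_, ?_⟩
    · rw [card_insert_of_notMem hv]
      push_cast
      refine hr.mul (Rl.lz hvh (by positivity) ?_)
      apply inv_le_one_of_one_le₀
      have : (0 : ℝ) ≤ #T := by positivity
      linarith
    · rw [mul_assoc, lz, add_mul, mul_add, smul_mul_assoc, smul_mul_assoc, mul_smul_comm,
        mul_smul_comm, one_mul, h1, h2 v hvW.1 hvh hv, card_insert_of_notMem hv, Finset.insert_comm,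
        sum_insert (a := v) (by simp [hv, hvh]), smul_add, smul_smul]
      push_cast
      congr 2
      · ring_nf
      · have : (#T : ℝ) + 1 ≠ 0 := by positivity
        field_simp
        ring
    · intro w hw hwh hwT
      rw [mem_insert, not_or] at hwT
      have : lz h v ((#T : ℝ) + 2)⁻¹ * (δ (swap h w) * e (W \ {h})) =
          δ (swap h w) * e (W \ {h}) := by
        rw [lz, add_mul, smul_mul_assoc, smul_mul_assoc, one_mul,
          coset_term hW (swap_Sy hW hvW.1) hw, swap_apply_of_ne_of_ne hwh hwT.1, ← add_smul]
        simp
      rw [mul_assoc, this, h2 w hw hwh hwT.2]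

lemma G.hub {V : Finset (Fin n)} (hV : h ∈ V) : G h V {h} ((#V : ℝ) - 1) := by
  obtain ⟨x, hr, h1, -⟩ := pass_aux hV (V \ {h}) subset_rfl
  have hi : insert h (V \ {h}) = V := by ext a; by_cases a = h <;> simp_all
  have hc : (#(V \ {h}) : ℝ) = #V - 1 := by
    have : #V = #(V \ {h}) + 1 := by
      conv_lhs => rw [← hi]
      rw [card_insert_of_notMem (by simp)]
    rw [this]; push_cast; ring
  rw [hc] at hr h1
  refine ⟨x, hr, ?_⟩
  rw [h1, hi, ← coset_formula hV, smul_smul]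
  have : (#V : ℝ) ≠ 0 := by
    have := card_pos.mpr ⟨h, hV⟩
    positivity
  simp [this]

lemma G.single {V : Finset (Fin n)} {z : Fin n} (hz : z ∈ V) : G h V {z} ((#V : ℝ) + 1) := by
  by_cases hzh : z = h
  · subst hzh; exact (G.hub hz).mono (by linarith)
  · have : G h (V.image (swap h z)) {h} ((#(V.image (swap h z)) : ℝ) - 1) :=
      G.hub (mem_image.mpr ⟨z, hz, by simp⟩)
    rw [card_image_of_injective _ (swap h z).injective] at this
    refine (G.conj (z := z) (k := (#V : ℝ) - 1) hzh ?_).mono (by linarith)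
    simpa using this

lemma G.naive {V : Finset (Fin n)} (Z : Finset (Fin n)) (hZ : Z ⊆ V) :
    G h V Z (#Z * ((#V : ℝ) + 1)) := by
  induction Z using Finset.induction_on generalizing V with
  | empty => simpa using G.empty V
  | insert z Z hz ih =>
    have h1 : G h V {z} ((#V : ℝ) + 1) := G.single (hZ (mem_insert_self _ _))
    have h2 := ih (V := V \ {z}) (by
      intro a ha
      simp only [mem_sdiff, mem_singleton]
      refine ⟨hZ (mem_insert_of_mem ha), ?_⟩
      rintro rfl; exact hz ha)
    have h3 : (insert z Z) \ {z} = Z := by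
      ext a; by_cases a = z <;> simp_all
    have hle : (#(V \ {z}) : ℝ) ≤ #V := by exact_mod_cast card_le_card sdiff_subset
    refine (G.batch (Y := {z}) (by simp) (h3.symm ▸ h2) h1).mono ?_
    rw [h3, card_insert_of_notMem hz]
    push_cast
    have : (#Z : ℝ) * ((#(V \ {z}) : ℝ) + 1) ≤ #Z * ((#V : ℝ) + 1) := by gcongr
    linarith

/-- constant cost for a full shuffle of a small set -/
lemma Rl.full (Z : Finset (Fin n)) : Rl h (#Z * ((#Z : ℝ) + 1)) (e Z) := by
  obtain ⟨x, hr, hx⟩ := G.naive (h := h) Z subset_rfl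
  rw [sdiff_self, bot_eq_empty, e_empty, mul_one] at hx
  rwa [hx] at hr

end Shf

namespace Shf

open Equiv Finset

variable {n : ℕ} {h : Fin n}

lemma image_mul (S : Finset (Fin n)) (σ τ : Perm (Fin n)) :
    S.image (σ * τ) = (S.image τ).image σ := by
  rw [image_image]; rfl

lemma exists_restrict {Z : Finset (Fin n)} {g : Perm (Fin n)} (hg : Z.image g = Z) :
    ∃ g1 ∈ Sy Z, ∀ x ∈ Z, g1 x = g x := by
  have hp : ∀ x, g x ∈ Z ↔ x ∈ Z := by
    intro x
    constructor
    · intro hx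
      rw [← hg] at hx
      obtain ⟨y, hy, hxy⟩ := mem_image.mp hx
      exact g.injective hxy ▸ hy
    · intro hx
      rw [← hg]; exact mem_image_of_mem _ hx
  refine ⟨Perm.ofSubtype (g.subtypePerm (p := fun x => x ∈ Z) hp), ?_, ?_⟩
  · rw [mem_Sy]
    intro x hx
    exact Perm.ofSubtype_apply_of_not_mem _ hx
  · intro x hx
    rw [Perm.ofSubtype_apply_of_mem _ hx]
    simp

/-- base vector: `Z` and its complement in `V` are pre-mixed -/
noncomputable def E (V Z : Finset (Fin n)) : RA n := e Z * e (V \ Z)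

lemma E_stab {V Z : Finset (Fin n)} {g : Perm (Fin n)} (hg : g ∈ Sy V)
    (hgZ : Z.image g = Z) (hZV : Z ⊆ V) : δ g * E V Z = E V Z := by
  obtain ⟨g1, h1, h2⟩ := exists_restrict hgZ
  have h3 : g1⁻¹ * g ∈ Sy (V \ Z) := by
    apply Sy_sdiff (mul_Sy (inv_Sy (Sy_mono hZV h1)) hg)
    intro x hx
    rw [Perm.mul_apply, ← h2 x hx]; simp
  have h4 : Commute (δ (g1⁻¹ * g)) (e Z) := by
    apply δ_commute_e
    intro x hx
    rw [Perm.mul_apply, ← h2 x hx]; simp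
  have h5 : δ g = δ g1 * δ (g1⁻¹ * g) := by rw [δ_mul]; simp
  rw [E, h5, mul_assoc, ← mul_assoc _ (e Z), h4.eq, mul_assoc, δ_e h3, ← mul_assoc, δ_e h1]

lemma E_eq {V Z : Finset (Fin n)} {g g' : Perm (Fin n)} (hg : g ∈ Sy V) (hg' : g' ∈ Sy V)
    (hZV : Z ⊆ V) (heq : Z.image g = Z.image g') : δ g * E V Z = δ g' * E V Z := by
  apply δ_eq_of
  apply E_stab (mul_Sy (inv_Sy hg') hg) _ hZV
  rw [image_mul, heq, ← image_mul]
  simp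

open Classical in
/-- the vector of the configuration with occupied set `S` -/
noncomputable def u (V Z S : Finset (Fin n)) : RA n :=
  if hh : ∃ g ∈ Sy V, Z.image g = S then δ hh.choose * E V Z else 0

lemma u_eq {V Z : Finset (Fin n)} {g : Perm (Fin n)} (hg : g ∈ Sy V) (hZV : Z ⊆ V) :
    δ g * E V Z = u V Z (Z.image g) := by
  have hh : ∃ g' ∈ Sy V, Z.image g' = Z.image g := ⟨g, hg, rfl⟩
  rw [u, dif_pos hh]
  exact E_eq hg hh.choose_spec.1 hZV hh.choose_spec.2.symm

lemma u_self {V Z : Finset (Fin n)} (hZV : Z ⊆ V) : E V Z = u V Z Z := by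
  have := u_eq (one_Sy V) hZV
  rw [δ_one, one_mul] at this
  rw [this]; simp

lemma exists_move {V Z S : Finset (Fin n)} (hZ : Z ⊆ V) (hS : S ⊆ V) (hc : #Z = #S) :
    ∃ g ∈ Sy V, Z.image g = S := by
  obtain ⟨g, hg⟩ := Perm.exists_extending_pair
    (Sum.elim (fun x : Z => (x : Fin n)) (fun x : {x : Fin n // x ∉ V} => (x : Fin n)))
    (Sum.elim (fun x : Z => ((Z.equivOfCardEq hc) x : Fin n))
      (fun x : {x : Fin n // x ∉ V} => (x : Fin n)))
    (by
      apply Function.Injective.sumElim Subtype.val_injective Subtype.val_injective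
      intro a b hab
      apply b.2
      rw [← hab]
      exact hZ a.2)
    (by
      apply Function.Injective.sumElim
        (Subtype.val_injective.comp (Z.equivOfCardEq hc).injective) Subtype.val_injective
      intro a b hab
      apply b.2
      rw [← hab]
      exact hS (Z.equivOfCardEq hc a).2)
  refine ⟨g, ?_, ?_⟩
  · rw [mem_Sy]
    intro x hx
    exact hg (Sum.inr ⟨x, hx⟩)
  · apply eq_of_subset_of_card_le
    · intro y hy
      obtain ⟨x, hx, rfl⟩ := mem_image.mp hy
      have := hg (Sum.inl ⟨x, hx⟩)
      simp only [Sum.elim_inl] at this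
      rw [this]
      exact (Z.equivOfCardEq hc ⟨x, hx⟩).2
    · rw [card_image_of_injective _ g.injective, hc]

lemma δ_u {V Z S : Finset (Fin n)} {τ : Perm (Fin n)} (hτ : τ ∈ Sy V) (hZ : Z ⊆ V) (hS : S ⊆ V)
    (hc : #S = #Z) : δ τ * u V Z S = u V Z (S.image τ) := by
  obtain ⟨g, hg, rfl⟩ := exists_move hZ hS hc.symm
  rw [← u_eq hg hZ, δ_mul_assoc, u_eq (mul_Sy hτ hg) hZ, image_mul]

lemma e_u {V Z S : Finset (Fin n)} (hZ : Z ⊆ V) (hS : S ⊆ V) (hc : #S = #Z) :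
    e V * u V Z S = e V := by
  obtain ⟨g, hg, rfl⟩ := exists_move hZ hS hc.symm
  rw [← u_eq hg hZ, ← mul_assoc, e_δ hg, E, ← mul_assoc, e_mul_e' hZ, e_mul_e' sdiff_subset]

lemma sum_u {V Z : Finset (Fin n)} (hZ : Z ⊆ V) :
    ∑ S ∈ powersetCard (#Z) V, u V Z S = ((#V).choose (#Z) : ℝ) • e V := by
  have h1 : e V * (∑ S ∈ powersetCard (#Z) V, u V Z S) = ∑ S ∈ powersetCard (#Z) V, u V Z S := by
    apply e_mul_of_inv
    intro σ hs
    have key : ∀ τ ∈ Sy V, ∀ S ∈ powersetCard (#Z) V, S.image τ ∈ powersetCard (#Z) V := by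
      intro τ hτ S hS
      rw [mem_powersetCard] at *
      refine ⟨?_, ?_⟩
      · intro y hy
        obtain ⟨x, hx, rfl⟩ := mem_image.mp hy
        exact (Sy_apply_mem hτ).mpr (hS.1 hx)
      · rw [card_image_of_injective _ τ.injective, hS.2]
    rw [mul_sum, sum_congr rfl (fun S hS => δ_u hs hZ (mem_powersetCard.mp hS).1
      (mem_powersetCard.mp hS).2)]
    refine sum_bij' (fun S _ => S.image σ) (fun S _ => S.image (σ⁻¹ : Perm (Fin n))) ?_ ?_ ?_ ?_ ?_
    · exact key σ hs
    · exact key _ (inv_Sy hs)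
    · intro S _; simp only [← image_mul]; simp
    · intro S _; simp only [← image_mul]; simp
    · simp
  rw [← h1, mul_sum, sum_congr rfl (fun S hS => e_u hZ (mem_powersetCard.mp hS).1
      (mem_powersetCard.mp hS).2), sum_const, card_powersetCard, Nat.cast_smul_eq_nsmul]

/-- absorption -/
lemma e_abs {V Z S W : Finset (Fin n)} (hZ : Z ⊆ V) (hS : S ⊆ V) (hc : #S = #Z) (hW : W ⊆ V)
    (hd : Disjoint W S) : e W * u V Z S = u V Z S := by
  apply e_mul_of_inv
  intro σ hs
  rw [δ_u (Sy_mono hW hs) hZ hS hc]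
  congr 1
  have : ∀ x ∈ S, σ x = x := fun x hx =>
    mem_Sy.mp hs x (fun h' => Finset.disjoint_left.mp hd h' hx)
  calc S.image σ = S.image id := image_congr this
    _ = S := image_id

lemma exists_move_in {A S S' : Finset (Fin n)} (hc : #(S ∩ A) = #(S' ∩ A))
    (hd : S \ A = S' \ A) : ∃ τ ∈ Sy A, S.image τ = S' := by
  obtain ⟨τ, h1, h2⟩ := exists_move (inter_subset_right (s₁ := S)) (inter_subset_right (s₁ := S')) hc
  refine ⟨τ, h1, ?_⟩
  have h3 : (S \ A).image τ = S \ A := by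
    calc (S \ A).image τ = (S \ A).image id :=
          image_congr (fun x hx => mem_Sy.mp h1 x (mem_sdiff.mp hx).2)
      _ = S \ A := image_id
  calc S.image τ = ((S \ A) ∪ (S ∩ A)).image τ := by rw [sdiff_union_inter]
    _ = S' := by rw [image_union, h2, h3, hd, sdiff_union_inter]

lemma K_move {V Z A S S' : Finset (Fin n)} {K : RA n} (hK : ∀ τ ∈ Sy A, K * δ τ = K) (hA : A ⊆ V)
    (hZ : Z ⊆ V) (hS : S ⊆ V) (hSc : #S = #Z)
    (hc : #(S ∩ A) = #(S' ∩ A)) (hd : S \ A = S' \ A) : K * u V Z S = K * u V Z S' := by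
  obtain ⟨τ, h1, rfl⟩ := exists_move_in hc hd
  rw [← δ_u (Sy_mono hA h1) hZ hS hSc, ← mul_assoc, hK τ h1]

lemma image_swap_of {S : Finset (Fin n)} {x y : Fin n} (hx : x ∈ S) (hy : y ∉ S) :
    S.image (swap x y) = insert y (S \ {x}) := by
  ext a
  simp only [mem_image, mem_insert, mem_sdiff, mem_singleton]
  constructor
  · rintro ⟨b, hb, rfl⟩
    by_cases h1 : b = x
    · subst h1; simp
    · have h2 : b ≠ y := by rintro rfl; exact hy hb
      rw [swap_apply_of_ne_of_ne h1 h2]; tauto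
  · rintro (rfl | ⟨h1, h2⟩)
    · exact ⟨x, hx, by simp⟩
    · have h3 : a ≠ y := by rintro rfl; exact hy h1
      exact ⟨a, h1, swap_apply_of_ne_of_ne h2 h3⟩

lemma lz_u {V Z S : Finset (Fin n)} {a b : Fin n} (p : ℝ) (hZ : Z ⊆ V) (hS : S ⊆ V) (hc : #S = #Z)
    (ha : a ∈ S) (hb : b ∈ V) (hbS : b ∉ S) :
    lz a b p * u V Z S = p • u V Z (insert b (S \ {a})) + (1 - p) • u V Z S := by
  rw [lz, add_mul, smul_mul_assoc, smul_mul_assoc, one_mul, δ_u (swap_Sy (hS ha) hb) hZ hS hc,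
    image_swap_of ha hbS]

lemma G.premix {V Z : Finset (Fin n)} {x : RA n} {k : ℝ} (hZ : Z ⊆ V) (hr : Rl h k x)
    (hx : x * u V Z Z = e V) : G h V Z (k + #Z * ((#Z : ℝ) + 1)) :=
  ⟨x * e Z, hr.mul (Rl.full Z), by rw [mul_assoc]; rw [← u_self hZ] at hx; exact hx⟩

lemma G.peel {V Z : Finset (Fin n)} {x : Fin n} (hx : x ∉ V) (hZ : Z ⊆ V) (hc : #Z = 4) {k : ℝ}
    (hG : G h V Z k) : G h (insert x V) Z (k + 23) := by
  obtain ⟨y, hr, hy⟩ := hG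
  have hZ' : Z ⊆ insert x V := hZ.trans (subset_insert _ _)
  obtain ⟨z, hz⟩ : Z.Nonempty := by rw [← card_pos]; omega
  have hxz : z ≠ x := by rintro rfl; exact hx (hZ hz)
  have hxZ : x ∉ Z := fun hh => hx (hZ hh)
  set m := #V with hm
  set p : ℝ := 4 / (m + 1) with hp
  have hm4 : 4 ≤ m := by rw [← hc]; exact card_le_card hZ
  have hm4' : (4 : ℝ) ≤ m := by exact_mod_cast hm4
  have hp0 : 0 ≤ p := by positivity
  have hp1 : p ≤ 1 := by rw [hp, div_le_one (by positivity)]; linarith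
  refine (G.premix (k := k + 3) hZ' (hr.mul (Rl.any hxz hp0 hp1)) ?_).mono
    (by rw [hc]; norm_num; linarith)
  set S1 : Finset (Fin n) := insert x (Z \ {z}) with hS1
  have hS1V : S1 ⊆ insert x V := insert_subset_insert _ (sdiff_subset.trans hZ)
  have hcard1 : #(Z \ {z}) = 3 := by
    rw [card_sdiff_of_subset (by simpa using hz)]; simp [hc]
  have hS1c : #S1 = #Z := by
    rw [hS1, card_insert_of_notMem (by simp [hxZ]), hcard1, hc]
  have ab : ∀ S, S ⊆ insert x V → #S = #Z → Disjoint (V \ Z) S →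
      y * u (insert x V) Z S = e V * u (insert x V) Z S := by
    intro S h1 h2 h3
    rw [← e_abs hZ' h1 h2 (sdiff_subset.trans (subset_insert _ _)) h3, ← mul_assoc, hy,
      ← mul_assoc, e_mul_e' sdiff_subset]
  rw [mul_assoc, lz_u p hZ' hZ' rfl hz (mem_insert_self _ _) hxZ, mul_add, mul_smul_comm,
    mul_smul_comm, ab S1 hS1V hS1c, ab Z hZ' rfl sdiff_disjoint]
  swap
  · rw [Finset.disjoint_left]
    intro a ha hb
    rw [hS1, mem_insert] at hb
    rw [mem_sdiff] at ha hb
    rcases hb with rfl | hb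
    · exact hx ha.1
    · exact ha.2 hb.1
  have hsum := sum_u hZ'
  rw [hc] at hsum
  have h4 : e V * (∑ S ∈ powersetCard 4 (insert x V), u (insert x V) Z S) =
      (m.choose 4 : ℝ) • (e V * u (insert x V) Z Z) +
      (m.choose 3 : ℝ) • (e V * u (insert x V) Z S1) := by
    rw [powersetCard_succ_insert hx, sum_union, mul_add, mul_sum, mul_sum]
    · congr 1
      · rw [sum_congr rfl (g := fun _ => e V * u (insert x V) Z Z)]
        · rw [sum_const, card_powersetCard, Nat.cast_smul_eq_nsmul]
        · intro S hS
          rw [mem_powersetCard] at hS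
          apply K_move (A := V) (fun τ hτ => e_δ hτ) (subset_insert _ _) hZ'
            (hS.1.trans (subset_insert _ _)) (by rw [hS.2, hc])
          · rw [inter_eq_left.mpr hS.1, inter_eq_left.mpr hZ, hS.2, hc]
          · rw [sdiff_eq_empty_iff_subset.mpr hS.1, sdiff_eq_empty_iff_subset.mpr hZ]
      · rw [sum_image]
        · rw [sum_congr rfl (g := fun _ => e V * u (insert x V) Z S1)]
          · rw [sum_const, card_powersetCard, Nat.cast_smul_eq_nsmul]
          · intro S hS
            rw [mem_powersetCard] at hS
            have hxS : x ∉ S := fun hh => hx (hS.1 hh)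
            apply K_move (A := V) (fun τ hτ => e_δ hτ) (subset_insert _ _) hZ'
              (insert_subset_insert _ hS.1) (by rw [card_insert_of_notMem hxS, hS.2, hc])
            · rw [hS1, insert_inter_of_notMem hx, insert_inter_of_notMem hx,
                inter_eq_left.mpr hS.1, inter_eq_left.mpr (sdiff_subset.trans hZ), hS.2, hcard1]
            · rw [hS1, insert_sdiff_of_notMem _ hx, insert_sdiff_of_notMem _ hx,
                sdiff_eq_empty_iff_subset.mpr hS.1,
                sdiff_eq_empty_iff_subset.mpr (sdiff_subset.trans hZ)]
        · intro S hS S' hS' heq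
          rw [mem_coe, mem_powersetCard] at hS hS'
          have h1 : x ∉ S := fun hh => hx (hS.1 hh)
          have h2 : x ∉ S' := fun hh => hx (hS'.1 hh)
          rw [← erase_insert h1, heq, erase_insert h2]
    · rw [Finset.disjoint_left]
      intro S hS hS'
      rw [mem_powersetCard] at hS
      obtain ⟨S', -, rfl⟩ := mem_image.mp hS'
      exact hx (hS.1 (mem_insert_self _ _))
  rw [hsum, mul_smul_comm, e_mul_e (subset_insert _ _), card_insert_of_notMem hx, ← hm] at h4
  have hc1 : ((m : ℝ) + 1) * (m.choose 3 : ℝ) = ((m + 1).choose 4 : ℝ) * 4 := by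
    exact_mod_cast Nat.add_one_mul_choose_eq m 3
  have hc2 : ((m + 1).choose 4 : ℝ) = m.choose 3 + m.choose 4 := by
    exact_mod_cast Nat.choose_succ_succ m 3
  have hc3 : ((m + 1).choose 4 : ℝ) ≠ 0 := by
    have := Nat.choose_pos (show 4 ≤ m + 1 by omega)
    positivity
  have h5 := congrArg (fun w => ((m + 1).choose 4 : ℝ)⁻¹ • w) h4
  simp only [smul_smul, smul_add, inv_mul_cancel₀ hc3, one_smul] at h5
  have hm1 : (m : ℝ) + 1 ≠ 0 := by positivity
  have h6 : ((m + 1).choose 4 : ℝ)⁻¹ * (m.choose 3 : ℝ) = p := by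
    rw [hp]; field_simp; linarith
  have h7 : ((m + 1).choose 4 : ℝ)⁻¹ * (m.choose 4 : ℝ) = 1 - p := by
    have : (m.choose 4 : ℝ) = ((m + 1).choose 4 : ℝ) - m.choose 3 := by linarith
    rw [this, mul_sub, h6, inv_mul_cancel₀ hc3]
  rw [h6, h7] at h5
  rw [h5, add_comm]

end Shf

namespace Shf

open Equiv Finset

variable {n : ℕ} {h : Fin n}

lemma sum_powersetCard_union {M : Type*} [AddCommMonoid M] {A B : Finset (Fin n)}
    (hd : Disjoint A B) (k : ℕ) (F : Finset (Fin n) → M) :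
    ∑ S ∈ powersetCard k (A ∪ B), F S = ∑ p ∈ antidiagonal k,
      ∑ S1 ∈ powersetCard p.1 A, ∑ S2 ∈ powersetCard p.2 B, F (S1 ∪ S2) := by
  simp_rw [← sum_product']
  rw [sum_sigma']
  have key1 : ∀ S1 S2 : Finset (Fin n), S1 ⊆ A → S2 ⊆ B → (S1 ∪ S2) ∩ A = S1 := by
    intro S1 S2 h1 h2
    ext a
    have := @h1 a; have := @h2 a; have : a ∈ A → a ∉ B := fun hh => Finset.disjoint_left.mp hd hh
    simp only [mem_inter, mem_union]; tauto
  have key2 : ∀ S1 S2 : Finset (Fin n), S1 ⊆ A → S2 ⊆ B → (S1 ∪ S2) ∩ B = S2 := by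
    intro S1 S2 h1 h2
    ext a
    have := @h1 a; have := @h2 a; have : a ∈ A → a ∉ B := fun hh => Finset.disjoint_left.mp hd hh
    simp only [mem_inter, mem_union]; tauto
  have key3 : ∀ S, S ⊆ A ∪ B → (S ∩ A) ∪ (S ∩ B) = S := by
    intro S hS
    rw [← inter_union_distrib_left, inter_eq_left.mpr hS]
  have key4 : ∀ S, Disjoint (S ∩ A) (S ∩ B) := fun S =>
    disjoint_of_subset_left inter_subset_right (disjoint_of_subset_right inter_subset_right hd)
  refine sum_bij' (fun S _ => ⟨(#(S ∩ A), #(S ∩ B)), (S ∩ A, S ∩ B)⟩) (fun q _ => q.2.1 ∪ q.2.2)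
    ?_ ?_ ?_ ?_ ?_
  · intro S hS
    rw [mem_powersetCard] at hS
    simp only [mem_sigma, HasAntidiagonal.mem_antidiagonal, mem_product, mem_powersetCard, inter_subset_right,
      and_true]
    rw [← card_union_of_disjoint (key4 S), key3 S hS.1, hS.2]
  · rintro ⟨⟨i, j⟩, S1, S2⟩ hq
    simp only [mem_sigma, HasAntidiagonal.mem_antidiagonal, mem_product, mem_powersetCard] at hq ⊢
    refine ⟨union_subset_union hq.2.1.1 hq.2.2.1, ?_⟩
    rw [card_union_of_disjoint (disjoint_of_subset_left hq.2.1.1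
      (disjoint_of_subset_right hq.2.2.1 hd))]
    omega
  · intro S hS
    rw [mem_powersetCard] at hS
    exact key3 S hS.1
  · rintro ⟨⟨i, j⟩, S1, S2⟩ hq
    simp only [mem_sigma, HasAntidiagonal.mem_antidiagonal, mem_product, mem_powersetCard] at hq
    simp only [key1 S1 S2 hq.2.1.1 hq.2.2.1, key2 S1 S2 hq.2.1.1 hq.2.2.1, hq.2.1.2, hq.2.2.2]
  · intro S hS
    rw [mem_powersetCard] at hS
    simp only [key3 S hS.1]

lemma sum_type {A B C : Finset (Fin n)} (hAB : Disjoint A B) (hAC : Disjoint A C)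
    (hBC : Disjoint B C) (k : ℕ) (F : Finset (Fin n) → RA n) (φ : ℕ → ℕ → ℕ → RA n)
    (hF : ∀ S ∈ powersetCard k (A ∪ (B ∪ C)), F S = φ #(S ∩ A) #(S ∩ B) #(S ∩ C)) :
    ∑ S ∈ powersetCard k (A ∪ (B ∪ C)), F S = ∑ p ∈ antidiagonal k, ∑ q ∈ antidiagonal p.2,
      (((#A).choose p.1 : ℝ) * (((#B).choose q.1 : ℝ) * ((#C).choose q.2 : ℝ))) •
        φ p.1 q.1 q.2 := by
  rw [sum_congr rfl hF, sum_powersetCard_union (disjoint_union_right.mpr ⟨hAB, hAC⟩)]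
  refine sum_congr rfl fun p hp => ?_
  simp_rw [sum_powersetCard_union hBC]
  rw [sum_comm]
  refine sum_congr rfl fun q hq => ?_
  have : ∀ S1 ∈ powersetCard p.1 A, ∀ S2 ∈ powersetCard q.1 B, ∀ S3 ∈ powersetCard q.2 C,
      φ #((S1 ∪ (S2 ∪ S3)) ∩ A) #((S1 ∪ (S2 ∪ S3)) ∩ B) #((S1 ∪ (S2 ∪ S3)) ∩ C) =
      φ p.1 q.1 q.2 := by
    intro S1 h1 S2 h2 S3 h3
    rw [mem_powersetCard] at h1 h2 h3
    have e1 : (S1 ∪ (S2 ∪ S3)) ∩ A = S1 := by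
      ext a
      have := @h1.1 a; have := @h2.1 a; have := @h3.1 a
      have : a ∈ A → a ∉ B := fun hh => Finset.disjoint_left.mp hAB hh
      have : a ∈ A → a ∉ C := fun hh => Finset.disjoint_left.mp hAC hh
      simp only [mem_inter, mem_union]; tauto
    have e2 : (S1 ∪ (S2 ∪ S3)) ∩ B = S2 := by
      ext a
      have := @h1.1 a; have := @h2.1 a; have := @h3.1 a
      have : a ∈ A → a ∉ B := fun hh => Finset.disjoint_left.mp hAB hh
      have : a ∈ B → a ∉ C := fun hh => Finset.disjoint_left.mp hBC hh
      simp only [mem_inter, mem_union]; tauto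
    have e3 : (S1 ∪ (S2 ∪ S3)) ∩ C = S3 := by
      ext a
      have := @h1.1 a; have := @h2.1 a; have := @h3.1 a
      have : a ∈ A → a ∉ C := fun hh => Finset.disjoint_left.mp hAC hh
      have : a ∈ B → a ∉ C := fun hh => Finset.disjoint_left.mp hBC hh
      simp only [mem_inter, mem_union]; tauto
    rw [e1, e2, e3, h1.2, h2.2, h3.2]
  rw [sum_congr rfl fun S1 h1 => sum_congr rfl fun S2 h2 => sum_congr rfl fun S3 h3 =>
    this S1 h1 S2 h2 S3 h3]
  simp only [sum_const, card_powersetCard, ← Nat.cast_smul_eq_nsmul ℝ, smul_smul]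

/-- properties of the mixing kernel -/
structure Kern (A B C : Finset (Fin n)) (K : RA n) : Prop where
  dAB : Disjoint A B
  dAC : Disjoint A C
  dBC : Disjoint B C
  kA : ∀ τ ∈ Sy A, K * δ τ = K
  kB : ∀ τ ∈ Sy B, K * δ τ = K
  kC : ∀ τ ∈ Sy C, K * δ τ = K
  p1 : ∃ π ∈ Sy (A ∪ (B ∪ C)), K * δ π = K ∧ A.image π = B ∧ B.image π = A ∧ C.image π = C
  p2 : ∃ π ∈ Sy (A ∪ (B ∪ C)), K * δ π = K ∧ A.image π = A ∧ B.image π = C ∧ C.image π = B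
  kV : K * e (A ∪ (B ∪ C)) = e (A ∪ (B ∪ C))

variable {A B C Z : Finset (Fin n)} {K : RA n}

lemma Kern.type (hK : Kern A B C K) (hZ : Z ⊆ A ∪ (B ∪ C)) {S S' : Finset (Fin n)}
    (hS : S ⊆ A ∪ (B ∪ C)) (hS' : S' ⊆ A ∪ (B ∪ C)) (hSc : #S = #Z) (hSc' : #S' = #Z)
    (h1 : #(S ∩ A) = #(S' ∩ A)) (h2 : #(S ∩ B) = #(S' ∩ B)) (h3 : #(S ∩ C) = #(S' ∩ C)) :
    K * u (A ∪ (B ∪ C)) Z S = K * u (A ∪ (B ∪ C)) Z S' := by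
  obtain ⟨a, ha, ha'⟩ := exists_move inter_subset_right inter_subset_right h1
  obtain ⟨b, hb, hb'⟩ := exists_move inter_subset_right inter_subset_right h2
  obtain ⟨c, hc, hc'⟩ := exists_move inter_subset_right inter_subset_right h3
  have hAB := Finset.disjoint_left.mp hK.dAB
  have hAC := Finset.disjoint_left.mp hK.dAC
  have hBC := Finset.disjoint_left.mp hK.dBC
  have hm : a * b * c ∈ Sy (A ∪ (B ∪ C)) := by
    refine mul_Sy (mul_Sy (Sy_mono ?_ ha) (Sy_mono ?_ hb)) (Sy_mono ?_ hc)
    · exact subset_union_left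
    · exact subset_union_left.trans subset_union_right
    · exact subset_union_right.trans subset_union_right
  have him : S.image (a * b * c) = S' := by
    apply eq_of_subset_of_card_le
    · intro y hy
      obtain ⟨x, hx, rfl⟩ := mem_image.mp hy
      have hxV := hS hx
      simp only [Perm.mul_apply]
      rw [mem_union, mem_union] at hxV
      rcases hxV with hx' | hx' | hx'
      · rw [mem_Sy.mp hc x (hAC hx'), mem_Sy.mp hb x (hAB hx')]
        have : a x ∈ S' ∩ A := by
          rw [← ha']; exact mem_image_of_mem _ (mem_inter.mpr ⟨hx, hx'⟩)
        exact (mem_inter.mp this).1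
      · rw [mem_Sy.mp hc x (hBC hx')]
        have : b x ∈ S' ∩ B := by
          rw [← hb']; exact mem_image_of_mem _ (mem_inter.mpr ⟨hx, hx'⟩)
        rw [mem_inter] at this
        rw [mem_Sy.mp ha _ (fun hh => hAB hh this.2)]
        exact this.1
      · have : c x ∈ S' ∩ C := by
          rw [← hc']; exact mem_image_of_mem _ (mem_inter.mpr ⟨hx, hx'⟩)
        rw [mem_inter] at this
        rw [mem_Sy.mp hb _ (fun hh => hBC hh this.2), mem_Sy.mp ha _ (fun hh => hAC hh this.2)]
        exact this.1
    · rw [card_image_of_injective _ (Equiv.injective _), hSc, hSc']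
  rw [← him, ← δ_u hm hZ hS hSc, ← δ_mul, ← δ_mul, ← mul_assoc, ← mul_assoc, ← mul_assoc,
    hK.kA a ha, hK.kB b hb, hK.kC c hc]

lemma Sy_image_subset {V S : Finset (Fin n)} {τ : Perm (Fin n)} (hτ : τ ∈ Sy V) (hS : S ⊆ V) :
    S.image τ ⊆ V := by
  intro y hy
  obtain ⟨x, hx, rfl⟩ := mem_image.mp hy
  exact (Sy_apply_mem hτ).mpr (hS hx)

lemma card_image_inter {S A B : Finset (Fin n)} {π : Perm (Fin n)} (hp : A.image π = B) :
    #(S.image π ∩ B) = #(S ∩ A) := by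
  rw [← hp, ← image_inter _ _ π.injective, card_image_of_injective _ π.injective]

lemma Kern.perm1 (hK : Kern A B C K) (hZ : Z ⊆ A ∪ (B ∪ C)) {S : Finset (Fin n)}
    (hS : S ⊆ A ∪ (B ∪ C)) (hSc : #S = #Z) : ∃ S', S' ⊆ A ∪ (B ∪ C) ∧ #S' = #Z ∧
      K * u (A ∪ (B ∪ C)) Z S = K * u (A ∪ (B ∪ C)) Z S' ∧
      #(S' ∩ A) = #(S ∩ B) ∧ #(S' ∩ B) = #(S ∩ A) ∧ #(S' ∩ C) = #(S ∩ C) := by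
  obtain ⟨π, h0, h1, h2, h3, h4⟩ := hK.p1
  refine ⟨S.image π, Sy_image_subset h0 hS, ?_, ?_, card_image_inter h3, card_image_inter h2,
    card_image_inter h4⟩
  · rw [card_image_of_injective _ π.injective, hSc]
  · rw [← δ_u h0 hZ hS hSc, ← mul_assoc, h1]

lemma Kern.perm2 (hK : Kern A B C K) (hZ : Z ⊆ A ∪ (B ∪ C)) {S : Finset (Fin n)}
    (hS : S ⊆ A ∪ (B ∪ C)) (hSc : #S = #Z) : ∃ S', S' ⊆ A ∪ (B ∪ C) ∧ #S' = #Z ∧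
      K * u (A ∪ (B ∪ C)) Z S = K * u (A ∪ (B ∪ C)) Z S' ∧
      #(S' ∩ A) = #(S ∩ A) ∧ #(S' ∩ B) = #(S ∩ C) ∧ #(S' ∩ C) = #(S ∩ B) := by
  obtain ⟨π, h0, h1, h2, h3, h4⟩ := hK.p2
  refine ⟨S.image π, Sy_image_subset h0 hS, ?_, ?_, card_image_inter h2, card_image_inter h4,
    card_image_inter h3⟩
  · rw [card_image_of_injective _ π.injective, hSc]
  · rw [← δ_u h0 hZ hS hSc, ← mul_assoc, h1]

lemma Kern.perm (hK : Kern A B C K) (hZ : Z ⊆ A ∪ (B ∪ C)) {S S' : Finset (Fin n)}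
    (hS : S ⊆ A ∪ (B ∪ C)) (hS' : S' ⊆ A ∪ (B ∪ C)) (hSc : #S = #Z) (hSc' : #S' = #Z)
    (hh : (#(S ∩ A) = #(S' ∩ A) ∧ #(S ∩ B) = #(S' ∩ B) ∧ #(S ∩ C) = #(S' ∩ C)) ∨
      (#(S ∩ A) = #(S' ∩ B) ∧ #(S ∩ B) = #(S' ∩ A) ∧ #(S ∩ C) = #(S' ∩ C)) ∨
      (#(S ∩ A) = #(S' ∩ A) ∧ #(S ∩ B) = #(S' ∩ C) ∧ #(S ∩ C) = #(S' ∩ B)) ∨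
      (#(S ∩ A) = #(S' ∩ B) ∧ #(S ∩ B) = #(S' ∩ C) ∧ #(S ∩ C) = #(S' ∩ A)) ∨
      (#(S ∩ A) = #(S' ∩ C) ∧ #(S ∩ B) = #(S' ∩ A) ∧ #(S ∩ C) = #(S' ∩ B)) ∨
      (#(S ∩ A) = #(S' ∩ C) ∧ #(S ∩ B) = #(S' ∩ B) ∧ #(S ∩ C) = #(S' ∩ A))) :
    K * u (A ∪ (B ∪ C)) Z S = K * u (A ∪ (B ∪ C)) Z S' := by
  obtain ⟨S1, a1, b1, c1, d1⟩ := hK.perm1 hZ hS hSc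
  obtain ⟨S2, a2, b2, c2, d2⟩ := hK.perm2 hZ hS hSc
  obtain ⟨S12, a12, b12, c12, d12⟩ := hK.perm1 hZ a2 b2
  obtain ⟨S21, a21, b21, c21, d21⟩ := hK.perm2 hZ a1 b1
  obtain ⟨S3, a3, b3, c3, d3⟩ := hK.perm1 hZ a21 b21
  rcases hh with hh | hh | hh | hh | hh | hh
  · apply hK.type hZ hS hS' hSc hSc' <;> omega
  · rw [c1]; apply hK.type hZ a1 hS' b1 hSc' <;> omega
  · rw [c2]; apply hK.type hZ a2 hS' b2 hSc' <;> omega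
  · by_cases h0 : #(S21 ∩ A) = #(S' ∩ A) ∧ #(S21 ∩ B) = #(S' ∩ B)
    · rw [c1, c21]; apply hK.type hZ a21 hS' b21 hSc' <;> omega
    · rw [c2, c12]; apply hK.type hZ a12 hS' b12 hSc' <;> omega
  · by_cases h0 : #(S21 ∩ A) = #(S' ∩ A) ∧ #(S21 ∩ B) = #(S' ∩ B)
    · rw [c1, c21]; apply hK.type hZ a21 hS' b21 hSc' <;> omega
    · rw [c2, c12]; apply hK.type hZ a12 hS' b12 hSc' <;> omega
  · rw [c1, c21, c3]; apply hK.type hZ a3 hS' b3 hSc' <;> omega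

set_option maxHeartbeats 1000000 in
lemma Kern.sum (hK : Kern A B C K) (hZ : Z ⊆ A ∪ (B ∪ C)) (hZ4 : #Z = 4) {m : ℕ}
    (hA : #A = m) (hB : #B = m) (hC : #C = m)
    {S0 S1 S2 S3 : Finset (Fin n)}
    (s0 : S0 ⊆ A ∪ (B ∪ C)) (t0 : #(S0 ∩ A) = 4 ∧ #(S0 ∩ B) = 0 ∧ #(S0 ∩ C) = 0)
    (s1 : S1 ⊆ A ∪ (B ∪ C)) (t1 : #(S1 ∩ A) = 3 ∧ #(S1 ∩ B) = 1 ∧ #(S1 ∩ C) = 0)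
    (s2 : S2 ⊆ A ∪ (B ∪ C)) (t2 : #(S2 ∩ A) = 2 ∧ #(S2 ∩ B) = 2 ∧ #(S2 ∩ C) = 0)
    (s3 : S3 ⊆ A ∪ (B ∪ C)) (t3 : #(S3 ∩ A) = 2 ∧ #(S3 ∩ B) = 1 ∧ #(S3 ∩ C) = 1) :
    ((3 * m).choose 4 : ℝ) • e (A ∪ (B ∪ C)) =
      (3 * (m.choose 4 : ℝ)) • (K * u (A ∪ (B ∪ C)) Z S0) +
      (6 * (m.choose 3 : ℝ) * m) • (K * u (A ∪ (B ∪ C)) Z S1) +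
      (3 * (m.choose 2 : ℝ) ^ 2) • (K * u (A ∪ (B ∪ C)) Z S2) +
      (3 * (m.choose 2 : ℝ) * m ^ 2) • (K * u (A ∪ (B ∪ C)) Z S3) := by
  have hcd : ∀ S ⊆ A ∪ (B ∪ C), #S = #(S ∩ A) + #(S ∩ B) + #(S ∩ C) := by
    intro S hS
    conv_lhs => rw [← inter_eq_left.mpr hS]
    have d1 : Disjoint (S ∩ B) (S ∩ C) :=
      disjoint_of_subset_left inter_subset_right (disjoint_of_subset_right inter_subset_right hK.dBC)
    have d2 : Disjoint (S ∩ A) (S ∩ (B ∪ C)) :=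
      disjoint_of_subset_left inter_subset_right (disjoint_of_subset_right inter_subset_right
        (disjoint_union_right.mpr ⟨hK.dAB, hK.dAC⟩))
    rw [inter_union_distrib_left, card_union_of_disjoint d2, inter_union_distrib_left,
      card_union_of_disjoint d1]
    omega
  have hV : #(A ∪ (B ∪ C)) = 3 * m := by
    rw [card_union_of_disjoint (disjoint_union_right.mpr ⟨hK.dAB, hK.dAC⟩),
      card_union_of_disjoint hK.dBC]
    omega
  have c0 := hcd S0 s0
  have c1 := hcd S1 s1
  have c2 := hcd S2 s2
  have c3 := hcd S3 s3
  have hs := congrArg (fun w => K * w) (sum_u hZ)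
  simp only [mul_smul_comm, hK.kV, mul_sum] at hs
  rw [hV, hZ4] at hs
  rw [← hs]
  clear hs
  set f0 := K * u (A ∪ (B ∪ C)) Z S0 with hf0
  set f1 := K * u (A ∪ (B ∪ C)) Z S1 with hf1
  set f2 := K * u (A ∪ (B ∪ C)) Z S2 with hf2
  set f3 := K * u (A ∪ (B ∪ C)) Z S3 with hf3
  rw [sum_type hK.dAB hK.dAC hK.dBC 4 _
    (fun i j l => if i = 4 ∨ j = 4 ∨ l = 4 then f0 else if i = 3 ∨ j = 3 ∨ l = 3 then f1 else
      if i = 0 ∨ j = 0 ∨ l = 0 then f2 else f3)]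
  · rw [hA, hB, hC]
    simp [Finset.Nat.antidiagonal_succ]
    module
  · intro S hS
    rw [mem_powersetCard] at hS
    have c4 := hcd S hS.1
    rw [hS.2] at c4
    split_ifs with g1 g2 g3
    · apply hK.perm hZ hS.1 s0 (by omega) (by omega)
      obtain ⟨x', y', z'⟩ := t0
      have hd : (#(S ∩ A) = 0 ∧ #(S ∩ B) = 0 ∧ #(S ∩ C) = 4) ∨
          (#(S ∩ A) = 0 ∧ #(S ∩ B) = 4 ∧ #(S ∩ C) = 0) ∨
          (#(S ∩ A) = 4 ∧ #(S ∩ B) = 0 ∧ #(S ∩ C) = 0) := by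
        omega
      rcases hd with ⟨x, y, z⟩ | ⟨x, y, z⟩ | ⟨x, y, z⟩ <;> rw [x, y, z, x', y', z'] <;> decide
    · apply hK.perm hZ hS.1 s1 (by omega) (by omega)
      obtain ⟨x', y', z'⟩ := t1
      have hd : (#(S ∩ A) = 0 ∧ #(S ∩ B) = 1 ∧ #(S ∩ C) = 3) ∨
          (#(S ∩ A) = 0 ∧ #(S ∩ B) = 3 ∧ #(S ∩ C) = 1) ∨
          (#(S ∩ A) = 1 ∧ #(S ∩ B) = 0 ∧ #(S ∩ C) = 3) ∨
          (#(S ∩ A) = 1 ∧ #(S ∩ B) = 3 ∧ #(S ∩ C) = 0) ∨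
          (#(S ∩ A) = 3 ∧ #(S ∩ B) = 0 ∧ #(S ∩ C) = 1) ∨
          (#(S ∩ A) = 3 ∧ #(S ∩ B) = 1 ∧ #(S ∩ C) = 0) := by
        omega
      rcases hd with ⟨x, y, z⟩ | ⟨x, y, z⟩ | ⟨x, y, z⟩ | ⟨x, y, z⟩ | ⟨x, y, z⟩ | ⟨x, y, z⟩ <;> rw [x, y, z, x', y', z'] <;> decide
    · apply hK.perm hZ hS.1 s2 (by omega) (by omega)
      obtain ⟨x', y', z'⟩ := t2
      have hd : (#(S ∩ A) = 0 ∧ #(S ∩ B) = 2 ∧ #(S ∩ C) = 2) ∨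
          (#(S ∩ A) = 2 ∧ #(S ∩ B) = 0 ∧ #(S ∩ C) = 2) ∨
          (#(S ∩ A) = 2 ∧ #(S ∩ B) = 2 ∧ #(S ∩ C) = 0) := by
        omega
      rcases hd with ⟨x, y, z⟩ | ⟨x, y, z⟩ | ⟨x, y, z⟩ <;> rw [x, y, z, x', y', z'] <;> decide
    · apply hK.perm hZ hS.1 s3 (by omega) (by omega)
      obtain ⟨x', y', z'⟩ := t3
      have hd : (#(S ∩ A) = 1 ∧ #(S ∩ B) = 1 ∧ #(S ∩ C) = 2) ∨
          (#(S ∩ A) = 1 ∧ #(S ∩ B) = 2 ∧ #(S ∩ C) = 1) ∨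
          (#(S ∩ A) = 2 ∧ #(S ∩ B) = 1 ∧ #(S ∩ C) = 1) := by
        omega
      rcases hd with ⟨x, y, z⟩ | ⟨x, y, z⟩ | ⟨x, y, z⟩ <;> rw [x, y, z, x', y', z'] <;> decide

end Shf

namespace Shf

open Equiv Finset

variable {n : ℕ} {h : Fin n} {A B C : Finset (Fin n)} {X : RA n}

lemma e_pair {a b : Fin n} (hab : a ≠ b) : (e {a, b} : RA n) = lz a b (1 / 2) := by
  have h1 := coset_formula (h := a) (W := {a, b}) (by simp)
  have h2 : ({a, b} : Finset (Fin n)) \ {a} = {b} := by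
    ext x; simp only [mem_sdiff, mem_insert, mem_singleton]
    constructor
    · tauto
    · rintro rfl; exact ⟨Or.inr rfl, hab.symm⟩
  have h3 : (e {b} : RA n) = 1 := by
    have : Sy ({b} : Finset (Fin n)) = {1} := by
      ext σ
      simp only [mem_singleton]
      constructor
      · intro hs
        ext x
        by_cases hx : x = b
        · subst hx
          have := (Sy_apply_mem hs (x := x)).mpr (by simp)
          rw [mem_singleton] at this
          simp [this]
        · simp [mem_Sy.mp hs x (by simpa using hx)]
      · rintro rfl; exact one_Sy _
    simp [e, this, δ_one]
  rw [h2, h3, sum_pair hab, card_pair hab] at h1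
  have h4 := congrArg (fun w => (1 / 2 : ℝ) • w) h1
  simp only [smul_smul] at h4
  norm_num at h4
  rw [h4, lz, ← Equiv.Perm.one_def, δ_one]
  module

lemma rl_three {b c : Fin n} (hb : b ≠ h) (hc : c ≠ h) (hbc : b ≠ c) :
    Rl h 3 (e {h, b, c}) := by
  have : (e {h, b, c} : RA n) = lz h b (1 / 2) * lz h c (2 / 3) * lz h b (1 / 2) := by
    rw [← e_pair hb.symm]
    have h1 := coset_formula (h := c) (W := {h, b, c}) (by simp)
    have h2 : ({h, b, c} : Finset (Fin n)) \ {c} = {h, b} := by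
      ext x; simp only [mem_sdiff, mem_insert, mem_singleton]
      constructor
      · tauto
      · rintro (rfl | rfl)
        · exact ⟨Or.inl rfl, hc.symm⟩
        · exact ⟨Or.inr (Or.inl rfl), hbc⟩
    have hn1 : h ∉ ({b, c} : Finset (Fin n)) := by simp [hb.symm, hc.symm]
    have hn2 : b ∉ ({c} : Finset (Fin n)) := by simp [hbc]
    rw [h2, sum_insert hn1, sum_insert hn2, sum_singleton, card_insert_of_notMem hn1,
      card_insert_of_notMem hn2, card_singleton] at h1
    have h4 := congrArg (fun w => (1 / 3 : ℝ) • w) h1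
    simp only [smul_smul] at h4
    norm_num at h4
    rw [h4]
    have e0 : δ (swap h b) * e {h, b} = e {h, b} := δ_e (swap_Sy (by simp) (by simp))
    have e1 : δ (swap h b) * (δ (swap h c) * e {h, b}) = δ (swap c b) * e {h, b} := by
      conv_rhs => rw [← e0]
      rw [δ_mul_assoc, δ_mul_assoc]
      congr 2
      have := swap_conj (a := h) (b := b) (c := c) hb.symm hbc hc.symm
      rw [swap_comm c b, ← this]
      simp [mul_assoc]
    rw [mul_assoc]
    have e3 : lz h c (2 / 3) * e {h, b} =
        (2 / 3 : ℝ) • (δ (swap h c) * e {h, b}) + (1 / 3 : ℝ) • e {h, b} := by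
      rw [lz, add_mul, smul_mul_assoc, smul_mul_assoc, one_mul]; norm_num
    have e5 : lz h b (1 / 2) * (δ (swap h c) * e {h, b}) =
      (1 / 2 : ℝ) • (δ (swap c b) * e {h, b}) + (1 / 2 : ℝ) • (δ (swap h c) * e {h, b}) := by
        rw [lz, add_mul, smul_mul_assoc, smul_mul_assoc, one_mul, e1]; norm_num
    rw [← e_pair hb.symm] at e5
    rw [e3, mul_add, mul_smul_comm, mul_smul_comm, e_mul_e subset_rfl, e5]
    rw [swap_comm c h, ← Equiv.Perm.one_def, δ_one, one_mul]
    module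
  rw [this]
  exact (((Rl.lz hb (by norm_num) (by norm_num)).mul (Rl.lz hc (by norm_num) (by norm_num))).mul
    (Rl.lz hb (by norm_num) (by norm_num))).mono (by norm_num)

/-- properties of the triple-mixing element -/
structure Mix (A B C : Finset (Fin n)) (X : RA n) : Prop where
  comm : ∀ g : Perm (Fin n), (∀ x ∈ A ∪ (B ∪ C), g x = x) → Commute (δ g) X
  absorb : ∀ V, A ∪ (B ∪ C) ⊆ V → X * e V = e V
  p1 : ∃ π ∈ Sy (A ∪ (B ∪ C)), X * δ π = X ∧ A.image π = B ∧ B.image π = A ∧ C.image π = C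
  p2 : ∃ π ∈ Sy (A ∪ (B ∪ C)), X * δ π = X ∧ A.image π = A ∧ B.image π = C ∧ C.image π = B

lemma Mix.empty : Mix (∅ : Finset (Fin n)) ∅ ∅ 1 where
  comm := fun g _ => Commute.one_right _
  absorb := fun V _ => one_mul _
  p1 := ⟨1, one_Sy _, by simp [δ_one], by simp, by simp, by simp⟩
  p2 := ⟨1, one_Sy _, by simp [δ_one], by simp, by simp, by simp⟩

lemma Mix.ins (hM : Mix A B C X) {a b c : Fin n} (ha : a ∉ A ∪ (B ∪ C)) (hb : b ∉ A ∪ (B ∪ C))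
    (hc : c ∉ A ∪ (B ∪ C)) (hab : a ≠ b) (hac : a ≠ c) (hbc : b ≠ c) :
    Mix (insert a A) (insert b B) (insert c C) (X * e {a, b, c}) := by
  have hT : ∀ π ∈ Sy (A ∪ (B ∪ C)), Commute (δ π) (e {a, b, c}) := by
    intro π hp
    apply δ_commute_e
    intro x hx
    simp only [mem_insert, mem_singleton] at hx
    rcases hx with rfl | rfl | rfl
    · exact mem_Sy.mp hp _ ha
    · exact mem_Sy.mp hp _ hb
    · exact mem_Sy.mp hp _ hc
  have hsub : A ∪ (B ∪ C) ⊆ insert a A ∪ (insert b B ∪ insert c C) :=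
    union_subset_union (subset_insert _ _)
      (union_subset_union (subset_insert _ _) (subset_insert _ _))
  have hsubT : ({a, b, c} : Finset (Fin n)) ⊆ insert a A ∪ (insert b B ∪ insert c C) := by
    intro x hx
    simp only [mem_insert, mem_singleton] at hx
    simp only [mem_insert, mem_union]
    tauto
  have himg : ∀ W W' : Finset (Fin n), W ⊆ A ∪ (B ∪ C) → ∀ x y z w : Fin n,
      x ∉ A ∪ (B ∪ C) → y ∉ A ∪ (B ∪ C) → z ∉ A ∪ (B ∪ C) → w ∉ A ∪ (B ∪ C) →
      swap x y z = w → ∀ π ∈ Sy (A ∪ (B ∪ C)),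
      W.image π = W' → (insert z W).image (π * swap x y) = insert w W' := by
    intro W W' hW x y z w hx hy hz hw hzw π hp hWW
    rw [image_mul, image_insert, hzw, image_insert, mem_Sy.mp hp w hw]
    congr 1
    rw [← hWW]
    congr 1
    calc W.image (swap x y) = W.image id := by
          apply image_congr
          intro v hv
          apply swap_apply_of_ne_of_ne
          · rintro rfl; exact hx (hW hv)
          · rintro rfl; exact hy (hW hv)
      _ = W := image_id
  have hAs : A ⊆ A ∪ (B ∪ C) := subset_union_left
  have hBs : B ⊆ A ∪ (B ∪ C) := subset_union_left.trans subset_union_right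
  have hCs : C ⊆ A ∪ (B ∪ C) := subset_union_right.trans subset_union_right
  refine ⟨?_, ?_, ?_, ?_⟩
  · intro g hg
    refine (hM.comm g fun x hx => hg x (hsub hx)).mul_right (δ_commute_e fun x hx => hg x (hsubT hx))
  · intro V hV
    rw [mul_assoc, e_mul_e (hsubT.trans hV), hM.absorb V (hsub.trans hV)]
  · obtain ⟨π, h0, h1, h2, h3, h4⟩ := hM.p1
    refine ⟨π * swap a b, ?_, ?_, ?_, ?_, ?_⟩
    · exact mul_Sy (Sy_mono hsub h0) (swap_Sy (hsubT (by simp)) (hsubT (by simp)))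
    · rw [← δ_mul, mul_assoc, ← mul_assoc (e _), ← (hT π h0).eq, mul_assoc,
        e_δ (swap_Sy (by simp) (by simp)), ← mul_assoc, h1]
    · exact himg A B hAs a b a b ha hb ha hb (by simp) π h0 h2
    · exact himg B A hBs a b b a ha hb hb ha (by simp) π h0 h3
    · exact himg C C hCs a b c c ha hb hc hc (swap_apply_of_ne_of_ne hac.symm hbc.symm) π h0 h4
  · obtain ⟨π, h0, h1, h2, h3, h4⟩ := hM.p2
    refine ⟨π * swap b c, ?_, ?_, ?_, ?_, ?_⟩
    · exact mul_Sy (Sy_mono hsub h0) (swap_Sy (hsubT (by simp)) (hsubT (by simp)))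
    · rw [← δ_mul, mul_assoc, ← mul_assoc (e _), ← (hT π h0).eq, mul_assoc,
        e_δ (swap_Sy (by simp) (by simp)), ← mul_assoc, h1]
    · exact himg A A hAs b c a a hb hc ha ha (swap_apply_of_ne_of_ne hab hac) π h0 h2
    · exact himg B C hBs b c b c hb hc hb hc (by simp) π h0 h3
    · exact himg C B hCs b c c b hb hc hc hb (by simp) π h0 h4

lemma Mix.kern (hM : Mix A B C X) (hAB : Disjoint A B) (hAC : Disjoint A C) (hBC : Disjoint B C) :
    Kern A B C (X * (e A * (e B * e C))) := by
  have cAB := (e_commute_e hAB).eq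
  have cAC := (e_commute_e hAC).eq
  have cBC := (e_commute_e hBC).eq
  have hAs : A ⊆ A ∪ (B ∪ C) := subset_union_left
  have hBs : B ⊆ A ∪ (B ∪ C) := subset_union_left.trans subset_union_right
  have hCs : C ⊆ A ∪ (B ∪ C) := subset_union_right.trans subset_union_right
  have r1 : e A * (e B * e C) = e B * (e C * e A) := by
    rw [← mul_assoc, cAB, mul_assoc, cAC]
  have r2 : e A * (e B * e C) = e A * (e C * e B) := by
    rw [cBC]
  refine ⟨hAB, hAC, hBC, ?_, ?_, ?_, ?_, ?_, ?_⟩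
  · intro τ hτ
    rw [r1, mul_assoc, mul_assoc, mul_assoc, e_δ hτ]
  · intro τ hτ
    rw [r2, mul_assoc, mul_assoc, mul_assoc, e_δ hτ]
  · intro τ hτ
    rw [mul_assoc, mul_assoc, mul_assoc, e_δ hτ]
  · obtain ⟨π, h0, h1, h2, h3, h4⟩ := hM.p1
    refine ⟨π, h0, ?_, h2, h3, h4⟩
    have q1 := δ_e_comm π A
    have q2 := δ_e_comm π B
    have q3 := δ_e_comm π C
    rw [h2] at q1
    rw [h3] at q2
    rw [h4] at q3
    calc X * (e A * (e B * e C)) * δ π = X * (e A * (e B * (e C * δ π))) := by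
          simp only [mul_assoc]
      _ = X * δ π * (e B * (e A * e C)) := by
          rw [← q3, ← mul_assoc (e B), ← q1, mul_assoc, ← mul_assoc (e A) (δ π), ← q2]
          simp only [mul_assoc]
      _ = X * (e A * (e B * e C)) := by
          rw [h1, ← mul_assoc (e B), ← cAB, mul_assoc]
  · obtain ⟨π, h0, h1, h2, h3, h4⟩ := hM.p2
    refine ⟨π, h0, ?_, h2, h3, h4⟩
    have q1 := δ_e_comm π A
    have q2 := δ_e_comm π B
    have q3 := δ_e_comm π C
    rw [h2] at q1
    rw [h3] at q2
    rw [h4] at q3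
    calc X * (e A * (e B * e C)) * δ π = X * (e A * (e B * (e C * δ π))) := by
          simp only [mul_assoc]
      _ = X * δ π * (e A * (e C * e B)) := by
          rw [← q2, ← mul_assoc (e B), ← q3, mul_assoc, ← mul_assoc (e A) (δ π), ← q1]
          simp only [mul_assoc]
      _ = X * (e A * (e B * e C)) := by
          rw [h1, ← cBC]
  · rw [mul_assoc, mul_assoc, mul_assoc, e_mul_e hCs, e_mul_e hBs, e_mul_e hAs,
      hM.absorb _ subset_rfl]

lemma mix_exists (m : ℕ) : ∀ A B C : Finset (Fin n), #A = m → #B = m → #C = m → Disjoint A B →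
    Disjoint A C → Disjoint B C → h ∉ A ∪ (B ∪ C) →
    ∃ D ∈ Sy (insert h (A ∪ (B ∪ C))), ∃ X, Mix A B C X ∧ Rl h (4 * m) (δ D * X) := by
  induction m with
  | zero =>
    intro A B C hA hB hC _ _ _ _
    rw [card_eq_zero] at hA hB hC
    subst hA; subst hB; subst hC
    exact ⟨1, one_Sy _, 1, Mix.empty, by simpa [δ_one] using Rl.one⟩
  | succ m ih =>
    intro A B C hA hB hC hAB hAC hBC hh
    obtain ⟨a, A', ha, rfl, hA'⟩ := card_eq_succ.mp hA
    obtain ⟨b, B', hb, rfl, hB'⟩ := card_eq_succ.mp hB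
    obtain ⟨c, C', hc, rfl, hC'⟩ := card_eq_succ.mp hC
    simp only [disjoint_insert_left, disjoint_insert_right, mem_insert, not_or, mem_union]
      at hAB hAC hBC hh
    obtain ⟨D, hD, X, hM, hR⟩ := ih A' B' C' hA' hB' hC' hAB.2.2 hAC.2.2 hBC.2.2
      (by simp only [mem_union]; tauto)
    have hsub : insert h (A' ∪ (B' ∪ C')) ⊆
        insert h (insert a A' ∪ (insert b B' ∪ insert c C')) :=
      insert_subset_insert _ (union_subset_union (subset_insert _ _)
        (union_subset_union (subset_insert _ _) (subset_insert _ _)))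
    refine ⟨D * swap h a, mul_Sy (Sy_mono hsub hD) (swap_Sy (by simp) (by simp)),
      X * e {a, b, c}, hM.ins (by simp only [mem_union]; tauto) (by simp only [mem_union]; tauto)
        (by simp only [mem_union]; tauto) (by tauto) (by tauto) (by tauto), ?_⟩
    have hcm : Commute (δ (swap h a)) X := by
      apply hM.comm
      intro x hx
      apply swap_apply_of_ne_of_ne
      · rintro rfl; simp only [mem_union] at hx; tauto
      · rintro rfl; simp only [mem_union] at hx; tauto
    have h1 : δ (swap h a) * e {a, b, c} = e {h, b, c} * δ (swap h a) := by
      rw [δ_e_comm, image_insert, image_insert, image_singleton, swap_apply_right,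
        swap_apply_of_ne_of_ne (a := h) (b := a) (x := b) (by tauto) (by tauto),
        swap_apply_of_ne_of_ne (a := h) (b := a) (x := c) (by tauto) (by tauto)]
    have h2 : δ (D * swap h a) * (X * e {a, b, c}) =
        (δ D * X) * (e {h, b, c} * δ (swap h a)) := by
      rw [← h1, ← δ_mul, mul_assoc, mul_assoc, ← mul_assoc _ X, hcm.eq, mul_assoc]
    rw [h2]
    refine (hR.mul ((rl_three (b := b) (c := c) (by tauto) (by tauto) (by tauto)).mul
      (Rl.swap (b := a) (by tauto)))).mono ?_
    push_cast; linarith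

/-- full mixing sweep with the hub in `A` -/
lemma mix_hub {m : ℕ} (hA : #A = m) (hB : #B = m) (hC : #C = m) (hAB : Disjoint A B)
    (hAC : Disjoint A C) (hBC : Disjoint B C) (hh : h ∈ A) :
    ∃ D ∈ Sy (A ∪ (B ∪ C)), ∃ X, Mix A B C X ∧ Rl h (4 * m) (δ D * X) := by
  obtain ⟨A', hA', rfl⟩ : ∃ A', h ∉ A' ∧ A = insert h A' :=
    ⟨A.erase h, by simp, by rw [insert_erase hh]⟩
  rw [card_insert_of_notMem hA'] at hA
  subst hA
  obtain ⟨b, B', hb, rfl, hB'⟩ := card_eq_succ.mp hB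
  obtain ⟨c, C', hc, rfl, hC'⟩ := card_eq_succ.mp hC
  simp only [disjoint_insert_left, disjoint_insert_right, mem_insert, not_or] at hAB hAC hBC
  obtain ⟨D, hD, X, hM, hR⟩ := mix_exists (h := h) #A' A' B' C' rfl hB' hC' hAB.2.2 hAC.2.2 hBC.2.2
    (by simp only [mem_union]; tauto)
  have hsub : insert h (A' ∪ (B' ∪ C')) ⊆ insert h A' ∪ (insert b B' ∪ insert c C') := by
    intro x; simp only [mem_insert, mem_union]; tauto
  refine ⟨D, Sy_mono hsub hD, X * e {h, b, c}, hM.ins (by simp only [mem_union]; tauto)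
    (by simp only [mem_union]; tauto) (by simp only [mem_union]; tauto) (by tauto) (by tauto)
    (by tauto), ?_⟩
  rw [← mul_assoc]
  refine (hR.mul (rl_three (b := b) (c := c) (by tauto) (by tauto) (by tauto))).mono ?_
  push_cast; linarith

end Shf

namespace Shf

open Equiv Finset

lemma odds_exist (x : ℝ) (hx : 15 ≤ x) : ∃ o1 o2 o3 : ℝ, 0 ≤ o1 ∧ 0 ≤ o2 ∧ 0 ≤ o3 ∧
    (x - 3) * (o1 + o2 + o3) = 8 * x ∧
    (x - 2) * (x - 3) * (o1 * o2) = 6 * x * (x - 1) ∧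
    (x - 2) * (x - 3) * ((1 + o1) * (1 + o2) * (1 + o3)) = 3 * (3 * x - 1) * (3 * x - 2) := by
  have h2 : 0 < x - 2 := by linarith
  have h3 : 0 < x - 3 := by linarith
  have h23 : 0 < (x - 2) * (x - 3) := mul_pos h2 h3
  obtain ⟨Ev, hE⟩ : ∃ Ev, Ev = 8 * x / (x - 3) := ⟨_, rfl⟩
  obtain ⟨F, hF⟩ : ∃ F, F = 6 * x * (x - 1) / ((x - 2) * (x - 3)) := ⟨_, rfl⟩
  obtain ⟨Gv, hG⟩ : ∃ Gv, Gv = 3 * (3 * x - 1) * (3 * x - 2) / ((x - 2) * (x - 3)) := ⟨_, rfl⟩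
  have hE8 : 8 ≤ Ev := by rw [hE, le_div_iff₀ h3]; linarith
  have hF6 : 6 ≤ F := by rw [hF, le_div_iff₀ h23]; nlinarith
  have hF9 : F ≤ 9 := by rw [hF, div_le_iff₀ h23]; nlinarith
  have hG39 : Gv ≤ 39 := by rw [hG, div_le_iff₀ h23]; nlinarith
  have hEFG : 1 + Ev + F ≤ Gv := by
    have : Ev = 8 * x * (x - 2) / ((x - 2) * (x - 3)) := by rw [hE]; field_simp
    rw [this, hF, hG, ← sub_nonneg]
    have : 3 * (3 * x - 1) * (3 * x - 2) / ((x - 2) * (x - 3)) - (1 + 8 * x * (x - 2) /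
      ((x - 2) * (x - 3)) + 6 * x * (x - 1) / ((x - 2) * (x - 3))) =
      12 * x ^ 2 / ((x - 2) * (x - 3)) := by field_simp; ring
    rw [this]; positivity
  have hcont : ContinuousOn (fun s : ℝ => (1 + F + s) * (1 + Ev - s)) (Set.Icc 6 Ev) := by fun_prop
  have hivt := intermediate_value_Icc' (show (6 : ℝ) ≤ Ev by linarith) hcont
  have hmem : Gv ∈ Set.Icc ((1 + F + Ev) * (1 + Ev - Ev)) ((1 + F + 6) * (1 + Ev - 6)) := by
    constructor
    · nlinarith
    · nlinarith
  obtain ⟨s, ⟨hs6, hsE⟩, hs⟩ := hivt hmem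
  simp only at hs
  have hdisc : 0 ≤ s ^ 2 - 4 * F := by nlinarith
  have hsq := Real.sq_sqrt hdisc
  have hsn := Real.sqrt_nonneg (s ^ 2 - 4 * F)
  have hle : Real.sqrt (s ^ 2 - 4 * F) ≤ s := by
    apply Real.sqrt_le_iff.mpr
    constructor
    · linarith
    · linarith
  set d := Real.sqrt (s ^ 2 - 4 * F) with hd
  have hprod : (s + d) / 2 * ((s - d) / 2) = F := by nlinarith
  refine ⟨(s + d) / 2, (s - d) / 2, Ev - s, by linarith, by linarith, by linarith, ?_, ?_, ?_⟩
  · have : (s + d) / 2 + (s - d) / 2 + (Ev - s) = Ev := by ring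
    rw [this, hE]; field_simp
  · rw [hprod, hF]; field_simp
  · have : (1 + (s + d) / 2) * (1 + (s - d) / 2) = 1 + F + s := by
      rw [← hprod]; ring
    rw [this, show 1 + (Ev - s) = 1 + Ev - s by ring, hs, hG]; field_simp

lemma choose2 (m : ℕ) : (m.choose 2 : ℝ) = m * (m - 1) / 2 := Nat.cast_choose_two ℝ m

lemma choose3 (m : ℕ) : (m.choose 3 : ℝ) = m * (m - 1) * (m - 2) / 6 := by
  induction m with
  | zero => simp
  | succ k ih => rw [Nat.choose_succ_succ]; push_cast; rw [ih, choose2]; ring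

lemma choose4 (m : ℕ) : (m.choose 4 : ℝ) = m * (m - 1) * (m - 2) * (m - 3) / 24 := by
  induction m with
  | zero => simp
  | succ k ih => rw [Nat.choose_succ_succ]; push_cast; rw [ih, choose3]; ring

lemma probs_exist (m : ℕ) (hm : 15 ≤ m) : ∃ q1 q2 q3 : ℝ, (0 ≤ q1 ∧ q1 ≤ 1) ∧ (0 ≤ q2 ∧ q2 ≤ 1) ∧
    (0 ≤ q3 ∧ q3 ≤ 1) ∧
    ((3 * m).choose 4 : ℝ) * ((1 - q1) * (1 - q2) * (1 - q3)) = 3 * (m.choose 4 : ℝ) ∧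
    ((3 * m).choose 4 : ℝ) * (q1 * (1 - q2) * (1 - q3) + (1 - q1) * q2 * (1 - q3) +
      (1 - q1) * (1 - q2) * q3) = 6 * (m.choose 3 : ℝ) * m ∧
    ((3 * m).choose 4 : ℝ) * (q1 * q2 * (1 - q3)) = 3 * (m.choose 2 : ℝ) ^ 2 ∧
    ((3 * m).choose 4 : ℝ) * (q1 * (1 - q2) * q3 + (1 - q1) * q2 * q3 + q1 * q2 * q3) =
      3 * (m.choose 2 : ℝ) * m ^ 2 := by
  have hx : (15 : ℝ) ≤ m := by exact_mod_cast hm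
  obtain ⟨o1, o2, o3, p1, p2, p3, e1, e2, e3⟩ := odds_exist m hx
  have hq : ∀ o : ℝ, 0 ≤ o → 0 ≤ o / (1 + o) ∧ o / (1 + o) ≤ 1 := by
    intro o ho
    exact ⟨by positivity, by rw [div_le_one (by positivity)]; linarith⟩
  have hq' : ∀ o : ℝ, 0 ≤ o → 1 - o / (1 + o) = 1 / (1 + o) := by
    intro o ho
    have : 1 + o ≠ 0 := by positivity
    field_simp; ring
  have n1 : 1 + o1 ≠ 0 := by positivity
  have n2 : 1 + o2 ≠ 0 := by positivity
  have n3 : 1 + o3 ≠ 0 := by positivity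
  rw [choose2, choose3, choose4, choose4]
  push_cast
  set x : ℝ := (m : ℝ) with hxm
  -- N = 3 C(m,4) * Π (1+o)
  have hN : 3 * x * (3 * x - 1) * (3 * x - 2) * (3 * x - 3) / 24 =
      3 * (x * (x - 1) * (x - 2) * (x - 3) / 24) * ((1 + o1) * (1 + o2) * (1 + o3)) := by
    linear_combination (-(3 * x * (x - 1) / 24)) * e3
  have f0 : 3 * x * (3 * x - 1) * (3 * x - 2) * (3 * x - 3) / 24 * ((1 - o1 / (1 + o1)) *
      (1 - o2 / (1 + o2)) * (1 - o3 / (1 + o3))) = 3 * (x * (x - 1) * (x - 2) * (x - 3) / 24) := by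
    rw [hN, hq' _ p1, hq' _ p2, hq' _ p3]; field_simp
  have f1 : 3 * x * (3 * x - 1) * (3 * x - 2) * (3 * x - 3) / 24 *
      (o1 / (1 + o1) * (1 - o2 / (1 + o2)) * (1 - o3 / (1 + o3)) +
      (1 - o1 / (1 + o1)) * (o2 / (1 + o2)) * (1 - o3 / (1 + o3)) +
      (1 - o1 / (1 + o1)) * (1 - o2 / (1 + o2)) * (o3 / (1 + o3))) =
      6 * (x * (x - 1) * (x - 2) / 6) * x := by
    have : 3 * x * (3 * x - 1) * (3 * x - 2) * (3 * x - 3) / 24 *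
      (o1 / (1 + o1) * (1 - o2 / (1 + o2)) * (1 - o3 / (1 + o3)) +
      (1 - o1 / (1 + o1)) * (o2 / (1 + o2)) * (1 - o3 / (1 + o3)) +
      (1 - o1 / (1 + o1)) * (1 - o2 / (1 + o2)) * (o3 / (1 + o3))) =
      3 * (x * (x - 1) * (x - 2) * (x - 3) / 24) * (o1 + o2 + o3) := by
      rw [hN, hq' _ p1, hq' _ p2, hq' _ p3]; field_simp
    rw [this]
    linear_combination (3 * (x * (x - 1) * (x - 2)) / 24) * e1
  have f2 : 3 * x * (3 * x - 1) * (3 * x - 2) * (3 * x - 3) / 24 *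
      (o1 / (1 + o1) * (o2 / (1 + o2)) * (1 - o3 / (1 + o3))) = 3 * (x * (x - 1) / 2) ^ 2 := by
    have : 3 * x * (3 * x - 1) * (3 * x - 2) * (3 * x - 3) / 24 *
      (o1 / (1 + o1) * (o2 / (1 + o2)) * (1 - o3 / (1 + o3))) =
      3 * (x * (x - 1) * (x - 2) * (x - 3) / 24) * (o1 * o2) := by
      rw [hN, hq' _ p3]; field_simp
    rw [this]
    linear_combination (3 * (x * (x - 1)) / 24) * e2
  refine ⟨o1 / (1 + o1), o2 / (1 + o2), o3 / (1 + o3), hq _ p1, hq _ p2, hq _ p3, f0, f1, f2, ?_⟩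
  linear_combination (-1 : ℝ) * f0 - f1 - f2

variable {n : ℕ} {h : Fin n} {A B C Z : Finset (Fin n)}

/-- configurations reachable by the gadget -/
structure Cfg (A B C Z Q R S : Finset (Fin n)) (i j l : ℕ) : Prop where
  sub : S ⊆ A ∪ (B ∪ C)
  card : #S = #Z
  ca : #(S ∩ A) = i
  cb : #(S ∩ B) = j
  cc : #(S ∩ C) = l
  da : Disjoint (A \ Z) S
  db : Disjoint (B \ Q) S
  dc : Disjoint (C \ R) S

lemma Cfg.moveB {Q R S : Finset (Fin n)} {i j l : ℕ} (hc : Cfg A B C Z Q R S (i + 1) j l)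
    (hAB : Disjoint A B) (hAC : Disjoint A C) (hBC : Disjoint B C) {a b : Fin n}
    (haS : a ∈ S) (haA : a ∈ A) (hb : b ∈ B) (hbQ : b ∈ Q) (hbS : b ∉ S) :
    Cfg A B C Z Q R (insert b (S \ {a})) i (j + 1) l := by
  have hbA : b ∉ A := fun hh => Finset.disjoint_left.mp hAB hh hb
  have hbC : b ∉ C := fun hh => Finset.disjoint_left.mp hBC hb hh
  have haB : a ∉ B := fun hh => Finset.disjoint_left.mp hAB haA hh
  have haC : a ∉ C := fun hh => Finset.disjoint_left.mp hAC haA hh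
  have hpos : 0 < #S := card_pos.mpr ⟨a, haS⟩
  have dis : ∀ W, Disjoint W S → b ∉ W → Disjoint W (insert b (S \ {a})) := by
    intro W hW hbW
    rw [disjoint_insert_right]
    exact ⟨hbW, disjoint_of_subset_right sdiff_subset hW⟩
  refine ⟨?_, ?_, ?_, ?_, ?_, ?_, ?_, ?_⟩
  · intro x hx
    rw [mem_insert] at hx
    rcases hx with rfl | hx
    · simp [hb]
    · exact hc.sub (sdiff_subset hx)
  · rw [card_insert_of_notMem (by simp [hbS]), card_sdiff_of_subset (by simpa using haS), ← hc.card]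
    simp; omega
  · rw [insert_inter_of_notMem hbA]
    have : (S \ {a}) ∩ A = (S ∩ A) \ {a} := by ext x; simp; tauto
    rw [this, card_sdiff_of_subset (by simp [haS, haA]), hc.ca]; simp
  · have : insert b (S \ {a}) ∩ B = insert b (S ∩ B) := by
      ext x
      simp only [mem_inter, mem_insert, mem_sdiff, mem_singleton]
      constructor
      · tauto
      · rintro (rfl | ⟨h1, h2⟩)
        · exact ⟨Or.inl rfl, hb⟩
        · exact ⟨Or.inr ⟨h1, fun hh => haB (hh ▸ h2)⟩, h2⟩
    rw [this, card_insert_of_notMem (by simp [hbS]), hc.cb]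
  · rw [insert_inter_of_notMem hbC]
    have : (S \ {a}) ∩ C = S ∩ C := by
      ext x
      simp only [mem_inter, mem_sdiff, mem_singleton]
      constructor
      · tauto
      · rintro ⟨h1, h2⟩
        exact ⟨⟨h1, fun hh => haC (hh ▸ h2)⟩, h2⟩
    rw [this, hc.cc]
  · exact dis _ hc.da (by simp [hbA])
  · exact dis _ hc.db (by simp [hbQ])
  · exact dis _ hc.dc (by simp [hbC])

lemma Cfg.flip {Q R S : Finset (Fin n)} {i j l : ℕ} (hc : Cfg A B C Z Q R S i j l) :
    Cfg A C B Z R Q S i l j :=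
  ⟨by rw [union_comm C B]; exact hc.sub, hc.card, hc.ca, hc.cc, hc.cb, hc.da, hc.dc, hc.db⟩

lemma Cfg.moveC {Q R S : Finset (Fin n)} {i j l : ℕ} (hc : Cfg A B C Z Q R S (i + 1) j l)
    (hAB : Disjoint A B) (hAC : Disjoint A C) (hBC : Disjoint B C) {a b : Fin n}
    (haS : a ∈ S) (haA : a ∈ A) (hb : b ∈ C) (hbR : b ∈ R) (hbS : b ∉ S) :
    Cfg A B C Z Q R (insert b (S \ {a})) i j (l + 1) :=
  (hc.flip.moveB hAC hAB hBC.symm haS haA hb hbR hbS).flip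

end Shf

namespace Shf

open Equiv Finset

variable {n : ℕ} {h : Fin n} {A B C Z : Finset (Fin n)}

/-- application of the three block shuffles and the mixing sweep to a configuration -/
lemma blocks_apply {Q R S : Finset (Fin n)} {i j l : ℕ} (hc : Cfg A B C Z Q R S i j l)
    (hAB : Disjoint A B) (hAC : Disjoint A C) (hBC : Disjoint B C) (hZ : Z ⊆ A)
    {yA yB yC X : RA n} {D : Perm (Fin n)}
    (hA : yA * e (A \ Z) = e A) (hB : yB * e (B \ Q) = e B) (hC : yC * e (C \ R) = e C) :
    (δ D * X) * (yC * (yB * yA)) * u (A ∪ (B ∪ C)) Z S =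
      δ D * ((X * (e A * (e B * e C))) * u (A ∪ (B ∪ C)) Z S) := by
  have hAs : A ⊆ A ∪ (B ∪ C) := subset_union_left
  have hBs : B ⊆ A ∪ (B ∪ C) := subset_union_left.trans subset_union_right
  have hCs : C ⊆ A ∪ (B ∪ C) := subset_union_right.trans subset_union_right
  have hZ' := hZ.trans hAs
  set w := u (A ∪ (B ∪ C)) Z S with hw
  have aA : e (A \ Z) * w = w := e_abs hZ' hc.sub hc.card (sdiff_subset.trans hAs) hc.da
  have aB : e (B \ Q) * w = w := e_abs hZ' hc.sub hc.card (sdiff_subset.trans hBs) hc.db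
  have aC : e (C \ R) * w = w := e_abs hZ' hc.sub hc.card (sdiff_subset.trans hCs) hc.dc
  have s1 : yA * w = e A * w := by rw [← aA, ← mul_assoc, hA, ← mul_assoc, e_mul_e' sdiff_subset]
  have c1 := (e_commute_e (disjoint_of_subset_right (sdiff_subset (t := Q)) hAB)).eq
  have c2 := (e_commute_e (disjoint_of_subset_right (sdiff_subset (t := R)) hAC)).eq
  have c3 := (e_commute_e (disjoint_of_subset_right (sdiff_subset (t := R)) hBC)).eq
  have s2 : yB * (e A * w) = e B * (e A * w) := by
    have : e A * w = e (B \ Q) * (e A * w) := by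
      rw [← mul_assoc, ← c1, mul_assoc, aB]
    conv_lhs => rw [this, ← mul_assoc, hB]
  have s3 : yC * (e B * (e A * w)) = e C * (e B * (e A * w)) := by
    have : e B * (e A * w) = e (C \ R) * (e B * (e A * w)) := by
      rw [← mul_assoc (e (C \ R)), ← c3, mul_assoc, ← mul_assoc (e (C \ R)), ← c2, mul_assoc, aC]
    conv_lhs => rw [this, ← mul_assoc, hC]
  have cAB := (e_commute_e hAB).eq
  have cAC := (e_commute_e hAC).eq
  have cBC := (e_commute_e hBC).eq
  calc (δ D * X) * (yC * (yB * yA)) * w = (δ D * X) * (yC * (yB * (yA * w))) := by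
        simp only [mul_assoc]
    _ = (δ D * X) * ((e C * (e B * e A)) * w) := by
        rw [s1, s2, s3]; simp only [mul_assoc]
    _ = (δ D * X) * ((e A * (e B * e C)) * w) := by
        rw [← cAB, ← mul_assoc (e C), ← cAC, mul_assoc (e A), ← cBC]
    _ = _ := by simp only [mul_assoc]

lemma G.triple {m : ℕ} (hm : 15 ≤ m) (hA : #A = m) (hB : #B = m) (hC : #C = m)
    (hAB : Disjoint A B) (hAC : Disjoint A C) (hBC : Disjoint B C) (hh : h ∈ A) (hZ : Z ⊆ A)
    (hZ4 : #Z = 4) {k : ℝ} (hG : G h A Z k) : G h (A ∪ (B ∪ C)) Z (k + 7 * m + 32) := by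
  have hAs : A ⊆ A ∪ (B ∪ C) := subset_union_left
  have hBs : B ⊆ A ∪ (B ∪ C) := subset_union_left.trans subset_union_right
  have hCs : C ⊆ A ∪ (B ∪ C) := subset_union_right.trans subset_union_right
  have hZ' := hZ.trans hAs
  obtain ⟨q1, q2, q3, ⟨q10, q11⟩, ⟨q20, q21⟩, ⟨q30, q31⟩, w0, w1, w2, w3⟩ := probs_exist m hm
  obtain ⟨z1, hz1, z2, hz2, z3, hz3, n12, n13, n23⟩ := two_lt_card.mp (show 2 < #Z by omega)
  obtain ⟨b1, hb1, b2, hb2, nb⟩ := one_lt_card.mp (show 1 < #B by omega)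
  obtain ⟨c1, hc1⟩ := card_pos.mp (show 0 < #C by omega)
  have hAnB : ∀ x ∈ A, x ∉ B := fun x hx hx' => Finset.disjoint_left.mp hAB hx hx'
  have hAnC : ∀ x ∈ A, x ∉ C := fun x hx hx' => Finset.disjoint_left.mp hAC hx hx'
  have hBnC : ∀ x ∈ B, x ∉ C := fun x hx hx' => Finset.disjoint_left.mp hBC hx hx'
  obtain ⟨yA, rA, eA⟩ := hG
  obtain ⟨yB, rB, eB⟩ := G.naive (h := h) (V := B) {b1, b2} (by
    intro x hx; simp only [mem_insert, mem_singleton] at hx; rcases hx with rfl | rfl <;> assumption)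
  obtain ⟨yC, rC, eC⟩ := G.naive (h := h) (V := C) {c1} (by simpa using hc1)
  rw [card_pair nb, hB] at rB
  rw [card_singleton, hC] at rC
  obtain ⟨D, hD, X, hM, rX⟩ := mix_hub hA hB hC hAB hAC hBC hh
  have hK := hM.kern hAB hAC hBC
  set V := A ∪ (B ∪ C) with hV
  -- non-membership facts
  have b1Z : b1 ∉ Z := fun hx => hAnB _ (hZ hx) hb1
  have b2Z : b2 ∉ Z := fun hx => hAnB _ (hZ hx) hb2
  have c1Z : c1 ∉ Z := fun hx => hAnC _ (hZ hx) hc1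
  have c1b1 : c1 ≠ b1 := fun hx => hBnC _ hb1 (hx ▸ hc1)
  have c1b2 : c1 ≠ b2 := fun hx => hBnC _ hb2 (hx ▸ hc1)
  have z1b1 : z1 ≠ b1 := fun hx => b1Z (hx ▸ hz1)
  have z2b1 : z2 ≠ b1 := fun hx => b1Z (hx ▸ hz2)
  have z3b1 : z3 ≠ b1 := fun hx => b1Z (hx ▸ hz3)
  have z1b2 : z1 ≠ b2 := fun hx => b2Z (hx ▸ hz1)
  have z2b2 : z2 ≠ b2 := fun hx => b2Z (hx ▸ hz2)
  have z3b2 : z3 ≠ b2 := fun hx => b2Z (hx ▸ hz3)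
  have z3c1 : z3 ≠ c1 := fun hx => c1Z (hx ▸ hz3)
  -- configurations
  have C000 : Cfg A B C Z {b1, b2} {c1} Z 4 0 0 := by
    refine ⟨hZ', rfl, ?_, ?_, ?_, sdiff_disjoint, ?_, ?_⟩
    · rw [inter_eq_left.mpr hZ, hZ4]
    · rw [disjoint_iff_inter_eq_empty.mp (disjoint_of_subset_left hZ hAB), card_empty]
    · rw [disjoint_iff_inter_eq_empty.mp (disjoint_of_subset_left hZ hAC), card_empty]
    · exact (disjoint_of_subset_left hZ (disjoint_of_subset_right sdiff_subset hAB)).symm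
    · exact (disjoint_of_subset_left hZ (disjoint_of_subset_right sdiff_subset hAC)).symm
  have C100 := C000.moveB hAB hAC hBC hz1 (hZ hz1) hb1 (by simp) b1Z
  have C010 := C000.moveB hAB hAC hBC hz2 (hZ hz2) hb2 (by simp) b2Z
  have C110 := C100.moveB (a := z2) (b := b2) hAB hAC hBC (by simp [hz2, n12.symm]) (hZ hz2) hb2
    (by simp) (by simp [b2Z, nb.symm])
  have C001 := C000.moveC (a := z3) (b := c1) hAB hAC hBC hz3 (hZ hz3) hc1 (by simp) c1Z
  have m101 : z3 ∈ insert b1 (Z \ {z1}) := by simp [hz3, n13.symm]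
  have o101 : c1 ∉ insert b1 (Z \ {z1}) := by simp [c1Z, c1b1]
  have m011 : z3 ∈ insert b2 (Z \ {z2}) := by simp [hz3, n23.symm]
  have o011 : c1 ∉ insert b2 (Z \ {z2}) := by simp [c1Z, c1b2]
  have m110 : z2 ∈ insert b1 (Z \ {z1}) := by simp [hz2, n12.symm]
  have o110 : b2 ∉ insert b1 (Z \ {z1}) := by simp [b2Z, nb.symm]
  have m111 : z3 ∈ insert b2 (insert b1 (Z \ {z1}) \ {z2}) := by
    simp [hz3, n13.symm, n23.symm]
  have o111 : c1 ∉ insert b2 (insert b1 (Z \ {z1}) \ {z2}) := by simp [c1Z, c1b1, c1b2]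
  have C101 := C100.moveC (a := z3) (b := c1) hAB hAC hBC m101 (hZ hz3) hc1 (by simp) o101
  have C011 := C010.moveC (a := z3) (b := c1) hAB hAC hBC m011 (hZ hz3) hc1 (by simp) o011
  have C111 := C110.moveC (a := z3) (b := c1) hAB hAC hBC m111 (hZ hz3) hc1 (by simp) o111
  have rG : Rl h 9 (lz z3 c1 q3 * (lz z2 b2 q2 * lz z1 b1 q1)) :=
    ((Rl.any z3c1 q30 q31).mul ((Rl.any z2b2 q20 q21).mul (Rl.any z1b1 q10 q11))).mono
      (by norm_num)
  refine (G.premix (x := (δ D * X) * (yC * (yB * yA)) * (lz z3 c1 q3 * (lz z2 b2 q2 * lz z1 b1 q1)))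
    hZ' ((rX.mul (rC.mul (rB.mul rA))).mul rG) ?_).mono ?_
  swap
  · rw [hZ4]; push_cast; linarith
  have hb1V := hBs hb1
  have hb2V := hBs hb2
  have hc1V := hCs hc1
  have g1 := lz_u q1 hZ' hZ' rfl hz1 hb1V b1Z
  have g2 := lz_u q2 hZ' hZ' rfl hz2 hb2V b2Z
  have g3 := lz_u q2 hZ' C100.sub C100.card m110 hb2V o110
  have g4 := lz_u q3 hZ' hZ' rfl hz3 hc1V c1Z
  have g5 := lz_u q3 hZ' C100.sub C100.card m101 hc1V o101
  have g6 := lz_u q3 hZ' C010.sub C010.card m011 hc1V o011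
  have g7 := lz_u q3 hZ' C110.sub C110.card m111 hc1V o111
  have key : ∀ {S : Finset (Fin n)} {i j l : ℕ}, Cfg A B C Z {b1, b2} {c1} S i j l →
      (δ D * X) * (yC * (yB * yA)) * u V Z S = δ D * ((X * (e A * (e B * e C))) * u V Z S) :=
    fun hc => blocks_apply hc hAB hAC hBC hZ eA eB eC
  have hS := hK.sum hZ' hZ4 hA hB hC C000.sub ⟨C000.ca, C000.cb, C000.cc⟩ C100.sub
    ⟨C100.ca, C100.cb, C100.cc⟩ C110.sub ⟨C110.ca, C110.cb, C110.cc⟩ C101.sub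
    ⟨C101.ca, C101.cb, C101.cc⟩
  have k010 := hK.perm hZ' C010.sub C100.sub C010.card C100.card (by
    rw [C010.ca, C010.cb, C010.cc, C100.ca, C100.cb, C100.cc]; decide)
  have k001 := hK.perm hZ' C001.sub C100.sub C001.card C100.card (by
    rw [C001.ca, C001.cb, C001.cc, C100.ca, C100.cb, C100.cc]; decide)
  have k011 := hK.perm hZ' C011.sub C101.sub C011.card C101.card (by
    rw [C011.ca, C011.cb, C011.cc, C101.ca, C101.cb, C101.cc]; decide)
  have k111 := hK.perm hZ' C111.sub C101.sub C111.card C101.card (by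
    rw [C111.ca, C111.cb, C111.cc, C101.ca, C101.cb, C101.cc]; decide)
  rw [← hV] at hS k010 k001 k011 k111
  have j000 := key C000
  have j100 := key C100
  have j010 := key C010
  have j110 := key C110
  have j001 := key C001
  have j101 := key C101
  have j011 := key C011
  have j111 := key C111
  rw [k010] at j010
  rw [k001] at j001
  rw [k011] at j011
  rw [k111] at j111
  generalize (δ D * X) * (yC * (yB * yA)) = Y at j000 j100 j010 j110 j001 j101 j011 j111 ⊢
  clear key
  rw [mul_assoc Y, mul_assoc, mul_assoc, g1, mul_add, mul_smul_comm, mul_smul_comm, g2, g3]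
  simp only [mul_add, mul_smul_comm, smul_add, g4, g5, g6, g7, j000, j100, j010, j110, j001, j101,
    j011, j111]
  have hN : ((3 * m).choose 4 : ℝ) ≠ 0 := by
    have := Nat.choose_pos (show 4 ≤ 3 * m by omega)
    positivity
  rw [← w0, ← w1, ← w2, ← w3] at hS
  have hS2 := congrArg (fun w => δ D * (((3 * m).choose 4 : ℝ)⁻¹ • w)) hS
  simp only [smul_add, smul_smul, ← mul_assoc (((3 * m).choose 4 : ℝ)⁻¹), inv_mul_cancel₀ hN,
    one_mul, one_smul, mul_add (δ D), mul_smul_comm] at hS2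
  rw [δ_e hD] at hS2
  rw [hS2]
  module

end Shf

namespace Shf

open Equiv Finset

variable {n : ℕ} {h : Fin n}

lemma G.peels {V Z : Finset (Fin n)} (hZ : Z ⊆ V) (hc : #Z = 4) {k : ℝ} (hG : G h V Z k)
    (T : Finset (Fin n)) : Disjoint V T → G h (V ∪ T) Z (k + 23 * #T) := by
  induction T using Finset.induction_on with
  | empty => intro _; simpa using hG
  | insert x T hx ih =>
    intro hd
    rw [Finset.disjoint_insert_right] at hd
    have h1 := ih hd.2
    have h2 := G.peel (x := x) (by simp [hd.1, hx]) (hZ.trans subset_union_left) hc h1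
    rw [union_insert]
    refine h2.mono ?_
    rw [card_insert_of_notMem hx]
    push_cast
    linarith

lemma main4_aux (N : ℕ) : ∀ V Z : Finset (Fin n), #V = N → h ∈ V → Z ⊆ V → #Z = 4 →
    G h V Z (3.5 * (N : ℝ) + 100 * Real.log N) := by
  induction N using Nat.strong_induction_on with
  | _ N ih =>
  intro V Z hV hh hZ hZ4
  have hN4 : 4 ≤ N := by rw [← hV, ← hZ4]; exact card_le_card hZ
  have hlog3 : 1 ≤ Real.log 3 := by
    rw [Real.le_log_iff_exp_le (by norm_num)]
    have := Real.exp_one_lt_d9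
    linarith
  have hmono : ∀ a : ℝ, 3 ≤ a → 1 ≤ Real.log a := fun a ha =>
    hlog3.trans (Real.log_le_log (by norm_num) ha)
  have hNr : (4 : ℝ) ≤ N := by exact_mod_cast hN4
  by_cases hN : N < 48
  · refine (G.naive Z hZ).mono ?_
    rw [hZ4, hV]
    have h1 := hmono N (by linarith)
    have h2 : (N : ℝ) ≤ 48 := by exact_mod_cast hN.le
    push_cast
    linarith
  · obtain ⟨m, hm⟩ : ∃ m, m = N / 3 := ⟨_, rfl⟩
    have hm16 : 16 ≤ m := by omega
    have hic : #(insert h Z) ≤ m := (card_insert_le _ _).trans (by omega)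
    have hiV : insert h Z ⊆ V := insert_subset hh hZ
    obtain ⟨A, hiA, hAV, hA⟩ := exists_subsuperset_card_eq hiV hic (by omega : m ≤ #V)
    have hVA : #(V \ A) = N - m := by rw [card_sdiff_of_subset hAV, hV, hA]
    obtain ⟨B, hBV, hB⟩ := exists_subset_card_eq (show m ≤ #(V \ A) by omega)
    have hVB : #((V \ A) \ B) = N - m - m := by rw [card_sdiff_of_subset hBV, hVA, hB]
    obtain ⟨C, hCV, hC⟩ := exists_subset_card_eq (show m ≤ #((V \ A) \ B) by omega)
    have hVC : #(((V \ A) \ B) \ C) = N - m - m - m := by rw [card_sdiff_of_subset hCV, hVB, hC]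
    have hAB : Disjoint A B := disjoint_of_subset_right hBV disjoint_sdiff
    have hAC : Disjoint A C :=
      disjoint_of_subset_right (hCV.trans sdiff_subset) disjoint_sdiff
    have hBC : Disjoint B C := disjoint_of_subset_right hCV disjoint_sdiff
    have hhA : h ∈ A := hiA (mem_insert_self _ _)
    have hZA : Z ⊆ A := (subset_insert _ _).trans hiA
    have g1 := ih m (by omega) A Z hA hhA hZA hZ4
    have g2 := G.triple (by omega) hA hB hC hAB hAC hBC hhA hZA hZ4 g1
    have g3 := G.peels (hZA.trans subset_union_left) hZ4 g2 (((V \ A) \ B) \ C) (by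
      rw [Finset.disjoint_left]
      intro x hx hx'
      simp only [mem_union, mem_sdiff] at hx hx'
      tauto)
    have hU : A ∪ (B ∪ C) ∪ (((V \ A) \ B) \ C) = V := by
      have q1 : C ∪ (((V \ A) \ B) \ C) = (V \ A) \ B := union_sdiff_of_subset hCV
      have q2 : B ∪ ((V \ A) \ B) = V \ A := union_sdiff_of_subset hBV
      have q3 : A ∪ (V \ A) = V := union_sdiff_of_subset hAV
      rw [union_assoc, union_assoc, q1, q2, q3]
    rw [hU, hVC] at g3
    refine g3.mono ?_
    have k2 : ((N - m - m - m : ℕ) : ℝ) ≤ 2 := by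
      have : N - m - m - m ≤ 2 := by omega
      exact_mod_cast this
    have k3 : (3 : ℝ) * m ≤ N := by
      have : 3 * m ≤ N := by omega
      exact_mod_cast this
    have hm0 : (0 : ℝ) < m := by
      have : 0 < m := by omega
      exact_mod_cast this
    have k4 : Real.log 3 + Real.log m ≤ Real.log N := by
      rw [← Real.log_mul (by norm_num) hm0.ne']
      exact Real.log_le_log (by positivity) k3
    linarith

lemma main4 {V Z : Finset (Fin n)} (hZ : Z ⊆ V) (hZ4 : #Z = 4) :
    G h V Z (3.5 * (#V : ℝ) + 100 * Real.log #V + 2) := by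
  by_cases hh : h ∈ V
  · exact (main4_aux (#V) V Z rfl hh hZ hZ4).mono (by linarith)
  · obtain ⟨z, hz⟩ := card_pos.mp (show 0 < #Z by omega)
    have hzh : z ≠ h := by rintro rfl; exact hh (hZ hz)
    have hinj : Function.Injective (swap h z) := (swap h z).injective
    refine G.conj hzh (main4_aux (#V) _ _ (card_image_of_injective _ hinj) ?_
      (image_subset_image hZ) ((card_image_of_injective _ hinj).trans hZ4))
    exact mem_image.mpr ⟨z, hZ hz, by simp⟩

lemma batches (r l : ℕ) (N : ℝ) : ∀ V Z : Finset (Fin n), Z ⊆ V → #Z = 4 * l + r → (#V : ℝ) ≤ N →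
    G h V Z ((3.5 * l + r) * N + (l * (100 * Real.log N + 2) + r)) := by
  induction l with
  | zero =>
    intro V Z hZ hc hV
    refine (G.naive Z hZ).mono ?_
    rw [hc]
    push_cast
    have : (0 : ℝ) ≤ r := by positivity
    nlinarith
  | succ l ih =>
    intro V Z hZ hc hV
    obtain ⟨Y, hY, hYc⟩ := exists_subset_card_eq (show 4 ≤ #Z by omega)
    have g1 := ih (V \ Y) (Z \ Y) (sdiff_subset_sdiff hZ subset_rfl)
      (by rw [card_sdiff_of_subset hY]; omega)
      (le_trans (by exact_mod_cast card_le_card sdiff_subset) hV)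
    have g2 := main4 (h := h) (hY.trans hZ) hYc
    refine (G.batch hY g1 g2).mono ?_
    have hV4 : 4 ≤ #V := by rw [← hYc]; exact card_le_card (hY.trans hZ)
    have hVr : (4 : ℝ) ≤ #V := by exact_mod_cast hV4
    have := Real.log_le_log (by linarith) hV
    push_cast
    linarith

end Shf

namespace Shf

open Equiv Finset

variable {n : ℕ} {h : Fin n}

lemma card_Sy (W : Finset (Fin n)) : #(Sy W) = (#W).factorial := by
  have h1 := Fintype.card_congr (Perm.subtypeEquivSubtypePerm (fun x : Fin n => x ∈ W))
  rw [Fintype.card_perm, Fintype.card_coe] at h1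
  rw [h1, Fintype.card_subtype]
  rfl

/-- the placement functional -/
noncomputable def plc {t : ℕ} (ht : t ≤ n) (f : Fin t → Fin n) : RA n →ₗ[ℝ] ℝ where
  toFun x := ∑ σ : Perm (Fin n), if ∀ i : Fin t, σ (Fin.castLE ht i) = f i then x.coeff σ else 0
  map_add' x y := by
    rw [← sum_add_distrib]
    refine sum_congr rfl fun σ _ => ?_
    split_ifs
    · rw [MonoidAlgebra.coeff_add, Finsupp.add_apply]
    · simp
  map_smul' c x := by
    rw [RingHom.id_apply, smul_eq_mul, mul_sum]
    refine sum_congr rfl fun σ _ => ?_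
    split_ifs
    · rw [MonoidAlgebra.coeff_smul_apply, smul_eq_mul]
    · simp

lemma plc_apply {t : ℕ} (ht : t ≤ n) (f : Fin t → Fin n) (x : RA n) :
    plc ht f x = ∑ σ : Perm (Fin n),
      if ∀ i : Fin t, σ (Fin.castLE ht i) = f i then x.coeff σ else 0 := rfl

lemma plc_mul_δ {t : ℕ} (ht : t ≤ n) (f : Fin t → Fin n) (x : RA n) {τ : Perm (Fin n)}
    (hτ : ∀ i : Fin t, τ (Fin.castLE ht i) = Fin.castLE ht i) :
    plc ht f (x * δ τ) = plc ht f x := by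
  rw [plc_apply, plc_apply]
  refine Fintype.sum_equiv (Equiv.mulRight τ⁻¹) _ _ fun σ => ?_
  have hτ' : ∀ i : Fin t, τ⁻¹ (Fin.castLE ht i) = Fin.castLE ht i := fun i => by
    rw [Perm.inv_eq_iff_eq, hτ]
  simp only [Equiv.coe_mulRight, Perm.mul_apply, hτ']
  rw [δ, MonoidAlgebra.coeff_mul_single_apply, mul_one]

lemma plc_mul_e {t : ℕ} (ht : t ≤ n) (f : Fin t → Fin n) (x : RA n) {W : Finset (Fin n)}
    (hW : ∀ i : Fin t, Fin.castLE ht i ∉ W) : plc ht f (x * e W) = plc ht f x := by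
  unfold e
  rw [mul_smul_comm, mul_sum, map_smul, map_sum,
    sum_congr rfl (fun τ hτ => plc_mul_δ ht f x fun i => mem_Sy.mp hτ _ (hW i)), sum_const,
    nsmul_eq_mul, smul_eq_mul, inv_mul_cancel_left₀ (Sy_card_ne W)]

lemma plc_δ {t : ℕ} (ht : t ≤ n) (f : Fin t → Fin n) (τ : Perm (Fin n)) :
    plc ht f (δ τ) = if ∀ i : Fin t, τ (Fin.castLE ht i) = f i then 1 else 0 := by
  rw [plc_apply, sum_eq_single τ]
  · simp [δ]
  · intro σ _ hσ
    simp [δ, MonoidAlgebra.coeff_single, Finsupp.single_apply, hσ.symm]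
  · simp

/-- the starting positions -/
def strt {t : ℕ} (ht : t ≤ n) : Finset (Fin n) := univ.image (Fin.castLE ht)

lemma card_strt {t : ℕ} (ht : t ≤ n) : #(strt ht) = t := by
  rw [strt, card_image_of_injective _ (Fin.castLE_injective ht), card_univ, Fintype.card_fin]

lemma mem_strt {t : ℕ} (ht : t ≤ n) (i : Fin t) : Fin.castLE ht i ∈ strt ht :=
  mem_image_of_mem _ (mem_univ i)

lemma count_place {t : ℕ} (ht : t ≤ n) (f : Fin t → Fin n) (hf : Function.Injective f) :
    #(univ.filter fun σ : Perm (Fin n) => ∀ i : Fin t, σ (Fin.castLE ht i) = f i) =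
      (n - t).factorial := by
  have hc : #(univ \ strt ht) = n - t := by
    rw [card_sdiff_of_subset (subset_univ _), card_strt, card_univ, Fintype.card_fin]
  rw [← hc, ← card_Sy]
  have hex : ∃ g : Perm (Fin n), ∀ i : Fin t, g (Fin.castLE ht i) = f i := by
    obtain ⟨g, hg⟩ := (MulAction.isMultiplyPretransitive_iff (G := Perm (Fin n))
      (α := Fin n) (n := t)).mp (Equiv.Perm.isMultiplyPretransitive (Fin n) t)
      ⟨Fin.castLE ht, Fin.castLE_injective ht⟩ ⟨f, hf⟩
    exact ⟨g, fun i => by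
      have := congrArg (fun k : Fin t ↪ Fin n => k i) hg
      exact this⟩
  obtain ⟨g, hg⟩ := hex
  refine card_bij' (fun σ _ => g⁻¹ * σ) (fun σ _ => g * σ) ?_ ?_ ?_ ?_
  · intro σ hσ
    rw [mem_filter] at hσ
    rw [mem_Sy]
    intro x hx
    have hx' : x ∈ strt ht := by simpa using hx
    obtain ⟨i, -, rfl⟩ := mem_image.mp hx'
    rw [Perm.mul_apply, hσ.2 i, Perm.inv_eq_iff_eq, hg]
  · intro σ hσ
    rw [mem_Sy] at hσ
    rw [mem_filter]
    refine ⟨mem_univ _, fun i => ?_⟩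
    rw [Perm.mul_apply, hσ _ (by simp [mem_strt]), hg]
  · intro σ _; simp
  · intro σ _; simp

lemma plc_e_univ {t : ℕ} (ht : t ≤ n) (f : Fin t → Fin n) (hf : Function.Injective f) :
    plc ht f (e univ) = ((n - t).factorial : ℝ) / (n.factorial : ℝ) := by
  have hu : Sy (univ : Finset (Fin n)) = univ := by ext σ; simp [mem_Sy]
  rw [e, map_smul, map_sum, sum_congr rfl (fun τ _ => plc_δ ht f τ), card_Sy, hu, card_univ,
    Fintype.card_fin, sum_boole, count_place ht f hf, smul_eq_mul, div_eq_inv_mul]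

lemma Utstar_le {t : ℕ} (ht : t ≤ n) (hh : (h : ℕ) = 0) {k : ℝ} (hG : G h univ (strt ht) k) :
    (Utstar t n : ℝ) ≤ k := by
  obtain ⟨x, ⟨L, hL, hk, rfl⟩, hx⟩ := hG
  refine le_trans ?_ hk
  have : Utstar t n ≤ L.length := by
    refine Nat.sInf_le ⟨ht, L, rfl, ⟨fun s hs => (hL s hs).1, fun f hf => ?_⟩, fun s hs => ?_⟩
    · have h1 : placeProb ht L f = plc ht f (xl L) := by
        rw [plc_apply]
        simp only [coeff_xl]
        rfl
      rw [h1, ← plc_mul_e ht f (xl L) (W := univ \ strt ht) (fun i => by simp [mem_strt]), hx,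
        plc_e_univ ht f hf]
    · rw [LazyT.IsStar, (hL s hs).2, hh]
  exact_mod_cast this

lemma final (l r : ℕ) : ∃ C : ℝ, 0 < C ∧ ∀ n : ℕ, max (4 * l + r) 2 ≤ n →
      (Utstar (4 * l + r) n : ℝ) ≤ (7 * (l : ℝ) / 2 + r) * n + C * Real.log n := by
  have hlog2 : (1 / 2 : ℝ) ≤ Real.log 2 := by
    have := Real.log_two_gt_d9
    linarith
  refine ⟨100 * l + 4 * l + 2 * r + 1, by positivity, fun n hn => ?_⟩
  have ht : 4 * l + r ≤ n := (le_max_left _ _).trans hn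
  have h2 : 2 ≤ n := (le_max_right _ _).trans hn
  have hg := batches (h := (⟨0, by omega⟩ : Fin n)) r l (n : ℝ) univ (strt ht) (subset_univ _)
    (card_strt ht) (by simp)
  refine (Utstar_le ht rfl hg).trans ?_
  have h2r : (2 : ℝ) ≤ n := by exact_mod_cast h2
  have hl := Real.log_le_log (by norm_num) h2r
  have a1 : (0 : ℝ) ≤ l := by positivity
  have a2 : (0 : ℝ) ≤ r := by positivity
  have hL : 1 / 2 ≤ Real.log n := hlog2.trans hl
  have b1 := mul_le_mul_of_nonneg_left hL a1
  have b2 := mul_le_mul_of_nonneg_left hL a2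
  linarith

end Shf

theorem Utstar_fixed_t_linear (l r : ℕ) (hr : r < 3) (ht : 1 ≤ 4 * l + r) :
    ∃ C : ℝ, 0 < C ∧ ∀ n : ℕ, max (4 * l + r) 2 ≤ n →
      (Utstar (4 * l + r) n : ℝ) ≤ (7 * (l : ℝ) / 2 + r) * n + C * Real.log n := by
  exact Shf.final l r
end
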